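/- For every nonnegative integer n, a̅₅(20n+6) = 20·b̅₅(10n) and a̅₅(20n+14) = 20·b̅₅(10n+4). -/

import Mathlib

open scoped BigOperators

/-- The q-Pochhammer infinite product `(a; q)_∞ = ∏_{k≥0} (1 - a q^k)`. -/
noncomputable def qpoch (a q : ℂ) : ℂ := ∏' k : ℕ, (1 - a * q ^ k)

/-- `φ(-q) = (q;q)_∞² / (q²;q²)_∞`. -/
noncomputable def phiNeg (q : ℂ) : ℂ := qpoch q q ^ 2 / qpoch (q ^ 2) (q ^ 2)

/-- `ψ(-q) = (q;q)_∞ (q⁴;q⁴)_∞ / (q²;q²)_∞`. -/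
noncomputable def psiNeg (q : ℂ) : ℂ :=
  qpoch q q * qpoch (q ^ 4) (q ^ 4) / qpoch (q ^ 2) (q ^ 2)

namespace S19
open Complex

/-- weighted theta series -/
noncomputable def T (w : ℤ → ℂ) (t : ℂ) : ℂ := ∑' n : ℤ, w n * cexp (t * (n : ℂ) ^ 2)

/-- at most quadratic growth -/
def Wt (w : ℤ → ℂ) : Prop := ∃ C : ℝ, ∀ n : ℤ, ‖w n‖ ≤ C * ((n : ℝ) ^ 2 + 1)

lemma norm_exp_sq (t : ℂ) (n : ℤ) : ‖cexp (t * (n : ℂ) ^ 2)‖ = Real.exp (t.re * (n : ℝ) ^ 2) := by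
  rw [Complex.norm_exp]
  congr 1
  have : ((n : ℂ) ^ 2) = (((n : ℝ) ^ 2 : ℝ) : ℂ) := by push_cast; rfl
  rw [this, Complex.re_mul_ofReal]

lemma summable_bound {a : ℝ} (ha : a < 0) :
    Summable fun n : ℤ => ((n : ℝ) ^ 2 + 1) * Real.exp (a * (n : ℝ) ^ 2) := by
  have hr : ‖Real.exp a‖ < 1 := by
    rw [Real.norm_eq_abs, abs_of_pos (Real.exp_pos _)]
    simpa using ha
  have key : Summable fun n : ℕ => ((n : ℝ) ^ 2 + 1) * Real.exp (a * (n : ℝ) ^ 2) := by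
    have h1 : Summable fun n : ℕ => (n : ℝ) ^ 2 * Real.exp a ^ n + (n : ℝ) ^ 0 * Real.exp a ^ n :=
      (summable_pow_mul_geometric_of_norm_lt_one 2 hr).add
        (summable_pow_mul_geometric_of_norm_lt_one 0 hr)
    refine Summable.of_nonneg_of_le (fun n => by positivity) (fun n => ?_) h1
    rw [pow_zero, ← add_mul]
    refine mul_le_mul_of_nonneg_left ?_ (by positivity)
    rw [← Real.exp_nat_mul]
    apply Real.exp_le_exp.mpr
    have : (n : ℝ) ≤ (n : ℝ) ^ 2 := by
      exact_mod_cast Nat.le_self_pow (by norm_num) n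
    nlinarith
  refine Summable.of_nat_of_neg ?_ ?_
  · simpa using key
  · simpa using key

lemma Wt.summable_norm {w : ℤ → ℂ} (hw : Wt w) {t : ℂ} (ht : t.re < 0) :
    Summable fun n : ℤ => ‖w n * cexp (t * (n : ℂ) ^ 2)‖ := by
  obtain ⟨C, hC⟩ := hw
  refine Summable.of_nonneg_of_le (fun n => norm_nonneg _) (fun n => ?_)
    ((summable_bound ht).mul_left C)
  rw [norm_mul, norm_exp_sq, ← mul_assoc]
  exact mul_le_mul_of_nonneg_right (hC n) (Real.exp_pos _).le

lemma Wt.hasSum {w : ℤ → ℂ} (hw : Wt w) {t : ℂ} (ht : t.re < 0) :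
    HasSum (fun n : ℤ => w n * cexp (t * (n : ℂ) ^ 2)) (T w t) :=
  (hw.summable_norm ht).of_norm.hasSum

lemma Wt.of_bdd {w : ℤ → ℂ} (C : ℝ) (h : ∀ n, ‖w n‖ ≤ C) : Wt w := by
  refine ⟨C, fun n => (h n).trans ?_⟩
  have : 0 ≤ C := (norm_nonneg _).trans (h 0)
  nlinarith [mul_nonneg this (sq_nonneg (n : ℝ))]

lemma Wt.sq_of_bdd {w : ℤ → ℂ} (C : ℝ) (h : ∀ n, ‖w n‖ ≤ C) : Wt fun n => w n * (n : ℂ) ^ 2 := by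
  refine ⟨C, fun n => ?_⟩
  have : 0 ≤ C := (norm_nonneg _).trans (h 0)
  rw [norm_mul]
  have h2 : ‖(n : ℂ) ^ 2‖ = (n : ℝ) ^ 2 := by simp
  rw [h2]
  nlinarith [mul_le_mul_of_nonneg_right (h n) (sq_nonneg (n : ℝ))]

lemma Wt.lin_of_bdd {w : ℤ → ℂ} (C : ℝ) (h : ∀ n, ‖w n‖ ≤ C) : Wt fun n => w n * (n : ℂ) := by
  refine ⟨C, fun n => ?_⟩
  have : 0 ≤ C := (norm_nonneg _).trans (h 0)
  rw [norm_mul]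
  have h2 : ‖(n : ℂ)‖ = |(n : ℝ)| := by simp
  rw [h2]
  have h3 : |(n : ℝ)| ≤ (n : ℝ) ^ 2 + 1 := by
    rw [← sq_abs]; nlinarith [sq_nonneg (|(n : ℝ)| - 1), abs_nonneg (n : ℝ)]
  calc ‖w n‖ * |(n : ℝ)| ≤ C * |(n : ℝ)| := mul_le_mul_of_nonneg_right (h n) (abs_nonneg _)
    _ ≤ _ := mul_le_mul_of_nonneg_left h3 this

/-- the two-dimensional exponential -/
noncomputable def E2 (t : ℂ) (x : ℤ × ℤ) : ℂ := cexp (t * ((x.1 : ℂ) ^ 2 + (x.2 : ℂ) ^ 2))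

lemma hasSum_mul {w w' : ℤ → ℂ} (hw : Wt w) (hw' : Wt w') {t : ℂ} (ht : t.re < 0) :
    HasSum (fun x : ℤ × ℤ => w x.1 * w' x.2 * E2 t x) (T w t * T w' t) := by
  have h := (summable_mul_of_summable_norm (hw.summable_norm ht) (hw'.summable_norm ht)).hasSum
  rw [← tsum_mul_tsum_of_summable_norm (hw.summable_norm ht) (hw'.summable_norm ht)] at h
  refine h.congr_fun ?_ |> id
  intro x
  simp only [E2, mul_add, Complex.exp_add]
  ring

lemma hasDerivAt_T {w : ℤ → ℂ} (C : ℝ) (h : ∀ n, ‖w n‖ ≤ C) {t : ℂ} (ht : t.re < 0) :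
    HasDerivAt (T w) (T (fun n => w n * (n : ℂ) ^ 2) t) t := by
  have hw := Wt.of_bdd C h
  set U : Set ℂ := {z | z.re < t.re / 2} with hU
  have hUo : IsOpen U := isOpen_lt Complex.continuous_re continuous_const
  have htU : t ∈ U := by simp only [hU, Set.mem_ofPred_eq]; linarith
  have hs : Summable fun n : ℤ => C * (((n : ℝ) ^ 2 + 1) * Real.exp (t.re / 2 * (n : ℝ) ^ 2)) :=
    (summable_bound (by linarith)).mul_left C
  have hC0 : 0 ≤ C := (norm_nonneg _).trans (h 0)
  have hb : ∀ (n : ℤ), ∀ z ∈ U, ‖w n * cexp (z * (n : ℂ) ^ 2)‖ ≤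
      C * (((n : ℝ) ^ 2 + 1) * Real.exp (t.re / 2 * (n : ℝ) ^ 2)) := by
    intro n z hz
    rw [norm_mul, norm_exp_sq]
    refine mul_le_mul (h n) ?_ (Real.exp_pos _).le hC0
    have h1 : Real.exp (z.re * (n : ℝ) ^ 2) ≤ Real.exp (t.re / 2 * (n : ℝ) ^ 2) :=
      Real.exp_le_exp.mpr (mul_le_mul_of_nonneg_right (le_of_lt hz) (sq_nonneg _))
    nlinarith [Real.exp_pos (t.re / 2 * (n : ℝ) ^ 2), sq_nonneg (n : ℝ)]
  have hd : ∀ n : ℤ, DifferentiableOn ℂ (fun z => w n * cexp (z * (n : ℂ) ^ 2)) U := by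
    intro n; fun_prop
  have h1 := Complex.hasSum_deriv_of_summable_norm hs hd hUo hb htU
  have h2 : DifferentiableOn ℂ (fun z => ∑' n : ℤ, w n * cexp (z * (n : ℂ) ^ 2)) U :=
    Complex.differentiableOn_tsum_of_summable_norm hs hd hUo hb
  have h3 := (h2.differentiableAt (hUo.mem_nhds htU)).hasDerivAt
  have h4 : T (fun n => w n * (n : ℂ) ^ 2) t =
      deriv (fun z => ∑' n : ℤ, w n * cexp (z * (n : ℂ) ^ 2)) t := by
    rw [← h1.tsum_eq, T]
    refine tsum_congr fun n => ?_
    have : HasDerivAt (fun z : ℂ => w n * cexp (z * (n : ℂ) ^ 2))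
        (w n * (cexp (t * (n : ℂ) ^ 2) * (1 * (n : ℂ) ^ 2))) t :=
      (((hasDerivAt_id t).mul_const _).cexp).const_mul _
    rw [this.deriv]; ring
  rw [h4]
  exact h3

/-- the lattice map `x+iy = (2+i)(u+iv)` -/
def Lm (x : ℤ × ℤ) : ℤ × ℤ := (2 * x.1 - x.2, x.1 + 2 * x.2)

lemma Lm_inj : Function.Injective Lm := by
  rintro ⟨a, b⟩ ⟨c, d⟩ h
  simp only [Lm, Prod.mk.injEq] at h ⊢
  omega

lemma Lm_range (x : ℤ × ℤ) (h : (x.1 - 2 * x.2) % 5 = 0) : x ∈ Set.range Lm := by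
  obtain ⟨a, b⟩ := x
  simp only at h
  refine ⟨((2 * a + b) / 5, (2 * b - a) / 5), ?_⟩
  simp only [Lm, Prod.mk.injEq]
  omega

lemma E2_Lm (t : ℂ) (x : ℤ × ℤ) : E2 t (Lm x) = E2 (5 * t) x := by
  simp only [E2, Lm]
  congr 1
  push_cast
  ring

lemma lattice {t a b : ℂ} {G : ℤ × ℤ → ℂ}
    (h1 : HasSum (fun x => G x * E2 t x) a)
    (h0 : ∀ x : ℤ × ℤ, (x.1 - 2 * x.2) % 5 ≠ 0 → G x = 0)
    (h2 : HasSum (fun x => G (Lm x) * E2 (5 * t) x) b) : a = b := by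
  have h3 : HasSum ((fun x => G x * E2 t x) ∘ Lm) b := by
    refine h2.congr_fun ?_ |> id
    intro x
    simp only [Function.comp, E2_Lm]
  rw [Lm_inj.hasSum_iff] at h3
  · exact h1.unique h3
  · intro x hx
    rw [h0 x (fun h => hx (Lm_range x h)), zero_mul]

end S19

namespace S19
open Complex Filter Topology

/-- Euler product -/
noncomputable def Eu (q : ℂ) : ℂ := ∏' k : ℕ, (1 - q ^ (k + 1))

/-- finite Euler product -/
noncomputable def PP (q : ℂ) (N : ℕ) : ℂ := ∏ k ∈ Finset.range N, (1 - q ^ (k + 1))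

lemma one_sub_pow_ne {q : ℂ} (hq : ‖q‖ < 1) (k : ℕ) : 1 - q ^ (k + 1) ≠ 0 := by
  intro h
  have h1 : q ^ (k + 1) = 1 := (sub_eq_zero.mp h).symm
  have h2 : ‖q‖ ^ (k + 1) = 1 := by rw [← norm_pow, h1, norm_one]
  exact absurd h2 (pow_lt_one₀ (norm_nonneg _) hq (by omega)).ne

lemma PP_ne {q : ℂ} (hq : ‖q‖ < 1) (N : ℕ) : PP q N ≠ 0 :=
  Finset.prod_ne_zero_iff.mpr fun k _ => one_sub_pow_ne hq k

lemma Eu_ne {q : ℂ} (hq : ‖q‖ < 1) : Eu q ≠ 0 := by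
  have := tprod_one_add_ne_zero_of_summable (f := fun n : ℕ => -q ^ (n + 1))
    (fun i => by simpa [sub_eq_add_neg] using one_sub_pow_ne hq i)
    (by simpa using (summable_nat_add_iff 1).mpr (summable_geometric_of_lt_one (norm_nonneg _) hq))
  simpa [Eu, sub_eq_add_neg] using this

lemma PP_tendsto {q : ℂ} (hq : ‖q‖ < 1) : Tendsto (PP q) atTop (𝓝 (Eu q)) :=
  (ModularForm.multipliable_one_sub_pow hq).hasProd.tendsto_prod_nat

/-- reciprocal finite Euler product extended by zero to negative integers -/
noncomputable def rr (q : ℂ) (k : ℤ) : ℂ := if k < 0 then 0 else (PP q k.toNat)⁻¹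

lemma rr_rec {q : ℂ} (hq : ‖q‖ < 1) (k : ℤ) : rr q (k - 1) = (1 - q ^ k) * rr q k := by
  unfold rr
  rcases lt_trichotomy k 0 with h | h | h
  · rw [if_pos (by omega), if_pos h, mul_zero]
  · subst h; simp
  · rw [if_neg (by omega), if_neg (by omega)]
    obtain ⟨m, rfl⟩ : ∃ m : ℕ, k = m + 1 := ⟨(k - 1).toNat, by omega⟩
    have e1 : ((m : ℤ) + 1 - 1).toNat = m := by omega
    have e2 : ((m : ℤ) + 1).toNat = m + 1 := by omega
    rw [e1, e2]
    have e3 : PP q (m + 1) = PP q m * (1 - q ^ (m + 1)) := by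
      simp [PP, Finset.prod_range_succ]
    have e4 : q ^ ((m : ℤ) + 1) = q ^ (m + 1) := by exact_mod_cast rfl
    rw [e3, e4]
    have := one_sub_pow_ne hq m
    have := PP_ne hq m
    field_simp

lemma rr_tendsto {q : ℂ} (hq : ‖q‖ < 1) : Tendsto (rr q) atTop (𝓝 (Eu q)⁻¹) := by
  have h1 : Tendsto (fun k : ℤ => (PP q k.toNat)⁻¹) atTop (𝓝 (Eu q)⁻¹) := by
    refine ((PP_tendsto hq).inv₀ (Eu_ne hq)).comp ?_
    refine tendsto_atTop.mpr fun b => ?_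
    filter_upwards [eventually_ge_atTop (b : ℤ)] with k hk
    omega
  refine h1.congr' ?_
  filter_upwards [eventually_ge_atTop (0 : ℤ)] with k hk
  rw [rr, if_neg (by omega)]

lemma PP_bdd {q : ℂ} (hq : ‖q‖ < 1) : ∃ M : ℝ, ∀ k, ‖PP q k‖ ≤ M := by
  obtain ⟨M, hM⟩ := (Metric.isBounded_range_of_tendsto _ (PP_tendsto hq)).exists_norm_le
  exact ⟨M, fun k => hM _ ⟨k, rfl⟩⟩

lemma rr_bdd {q : ℂ} (hq : ‖q‖ < 1) : ∃ M : ℝ, 0 ≤ M ∧ ∀ k, ‖rr q k‖ ≤ M := by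
  obtain ⟨M, hM⟩ := (Metric.isBounded_range_of_tendsto _
    ((PP_tendsto hq).inv₀ (Eu_ne hq))).exists_norm_le
  have h0 : 0 ≤ M := (norm_nonneg _).trans (hM _ ⟨0, rfl⟩)
  refine ⟨M, h0, fun k => ?_⟩
  unfold rr
  split_ifs
  · simpa using h0
  · exact hM _ ⟨_, rfl⟩

/-- the basic theta term -/
noncomputable def ct (s t : ℂ) (n : ℤ) : ℂ := (-1) ^ n * cexp (n * s + n ^ 2 * t)

/-- Gaussian binomial -/
noncomputable def BB (q : ℂ) (N : ℕ) (n : ℤ) : ℂ := PP q (2 * N) * (rr q (N - n) * rr q (N + n))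

lemma ct_pred (s t : ℂ) (n : ℤ) :
    ct s t (n - 1) = - ct s t n * cexp (-s + (1 - 2 * n) * t) := by
  unfold ct
  rw [zpow_sub_one₀ (by norm_num), mul_comm, neg_mul, mul_assoc, ← Complex.exp_add]
  rw [show ((n - 1 : ℤ) : ℂ) * s + ((n - 1 : ℤ) : ℂ) ^ 2 * t
    = n * s + n ^ 2 * t + (-s + (1 - 2 * n) * t) by push_cast; ring]
  norm_num
  ring

lemma ct_succ (s t : ℂ) (n : ℤ) :
    ct s t (n + 1) = - ct s t n * cexp (s + (1 + 2 * n) * t) := by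
  unfold ct
  rw [zpow_add_one₀ (by norm_num), mul_comm, neg_mul, mul_assoc, ← Complex.exp_add]
  rw [show ((n + 1 : ℤ) : ℂ) * s + ((n + 1 : ℤ) : ℂ) ^ 2 * t
    = n * s + n ^ 2 * t + (s + (1 + 2 * n) * t) by push_cast; ring]
  norm_num
  ring

/-- product side -/
noncomputable def prodN (s t : ℂ) (N : ℕ) : ℂ :=
  ∏ k ∈ Finset.range N, ((1 - cexp (s + (2 * k + 1) * t)) * (1 - cexp (-s + (2 * k + 1) * t)))

lemma finiteJ (s : ℂ) {t : ℂ} (ht : t.re < 0) (N : ℕ) :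
    HasSum (fun n : ℤ => ct s t n * BB (cexp (2 * t)) N n) (prodN s t N) := by
  have hq : ‖cexp (2 * t)‖ < 1 := by
    rw [Complex.norm_exp]; simp; linarith
  set q := cexp (2 * t) with hqd
  have hq0 : q ≠ 0 := Complex.exp_ne_zero _
  induction N with
  | zero =>
    have h1 : prodN s t 0 = ct s t 0 * BB q 0 0 := by
      simp [prodN, ct, BB, rr, PP]
    rw [h1]
    refine hasSum_single 0 fun n hn => ?_
    rcases lt_or_gt_of_ne hn with h | h
    · have : rr q ((0 : ℕ) + n) = 0 := by rw [rr, if_pos (by simpa using h)]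
      rw [BB, this]; simp
    · have : rr q ((0 : ℕ) - n) = 0 := by rw [rr, if_pos (by simpa using h)]
      rw [BB, this]; simp
  | succ N ih =>
    have hp : prodN s t (N + 1) = prodN s t N *
        ((1 - cexp (s + (2 * N + 1) * t)) * (1 - cexp (-s + (2 * N + 1) * t))) := by
      simp [prodN, Finset.prod_range_succ]
    have hs1 := (Equiv.addRight (-1 : ℤ)).hasSum_iff.mpr ih
    have hs2 := (Equiv.addRight (1 : ℤ)).hasSum_iff.mpr ih
    have hc := ((ih.mul_left (1 + q ^ (2 * N + 1))).sub (hs1.mul_left (cexp (s + (2 * N + 1) * t)))).sub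
      (hs2.mul_left (cexp (-s + (2 * N + 1) * t)))
    have hval : (1 + q ^ (2 * N + 1)) * prodN s t N - cexp (s + (2 * N + 1) * t) * prodN s t N
        - cexp (-s + (2 * N + 1) * t) * prodN s t N = prodN s t (N + 1) := by
      rw [hp]
      have : q ^ (2 * N + 1) = cexp (s + (2 * N + 1) * t) * cexp (-s + (2 * N + 1) * t) := by
        rw [hqd, ← Complex.exp_add, ← Complex.exp_nat_mul]
        congr 1; push_cast; ring
      rw [this]; ring
    rw [hval] at hc
    refine hc.congr_fun fun n => ?_
    simp only [Function.comp, Equiv.coe_addRight, ← sub_eq_add_neg]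
    rw [ct_pred, ct_succ]
    have hA : cexp (s + (2 * N + 1) * t) * cexp (-s + (1 - 2 * n) * t) = q ^ ((N : ℤ) + 1 - n) := by
      rw [hqd, ← Complex.exp_add, ← Complex.exp_int_mul]
      congr 1; push_cast; ring
    have hB : cexp (-s + (2 * N + 1) * t) * cexp (s + (1 + 2 * n) * t) = q ^ ((N : ℤ) + 1 + n) := by
      rw [hqd, ← Complex.exp_add, ← Complex.exp_int_mul]
      congr 1; push_cast; ring
    have hAB : q ^ (2 * N + 1) * q = q ^ ((N : ℤ) + 1 - n) * q ^ ((N : ℤ) + 1 + n) := by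
      rw [← zpow_add₀ hq0, ← pow_succ, ← zpow_natCast]; congr 1; push_cast; ring
    have hPP : PP q (2 * (N + 1)) = PP q (2 * N) * (1 - q ^ (2 * N + 1)) * (1 - q ^ (2 * N + 1) * q) := by
      rw [show 2 * (N + 1) = 2 * N + 1 + 1 by ring]
      simp [PP, Finset.prod_range_succ, pow_succ]
    set A := q ^ ((N : ℤ) + 1 - n) with hAd
    set B := q ^ ((N : ℤ) + 1 + n) with hBd
    set R := rr q ((N : ℤ) + 1 - n) with hR
    set S := rr q ((N : ℤ) + 1 + n) with hS
    have r1 : rr q ((N : ℤ) - n) = (1 - A) * R := by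
      rw [hAd, hR, ← rr_rec hq]; congr 1; ring
    have r2 : rr q ((N : ℤ) + n) = (1 - B) * S := by
      rw [hBd, hS, ← rr_rec hq]; congr 1; ring
    have r3 : rr q ((N : ℤ) + (n - 1)) = (1 - B * q⁻¹) * ((1 - B) * S) := by
      rw [← r2, hBd, ← zpow_sub_one₀ hq0, show (N : ℤ) + 1 + n - 1 = N + n by ring, ← rr_rec hq]
      congr 1; ring
    have r4 : rr q ((N : ℤ) - (n + 1)) = (1 - A * q⁻¹) * ((1 - A) * R) := by
      rw [← r1, hAd, ← zpow_sub_one₀ hq0, show (N : ℤ) + 1 - n - 1 = N - n by ring, ← rr_rec hq]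
      congr 1; ring
    have r5 : rr q ((N : ℤ) - (n - 1)) = R := by rw [hR]; congr 1; ring
    have r6 : rr q ((N : ℤ) + (n + 1)) = S := by rw [hS]; congr 1; ring
    have hX : q ^ (2 * N + 1) = A * B * q⁻¹ := by
      rw [← hAB]; field_simp
    simp only [BB]
    push_cast
    rw [← hR, ← hS, r1, r2, r3, r4, r5, r6, hPP, hX]
    have hA' : ∀ x y w : ℂ, cexp (s + (2 * N + 1) * t) * (x * cexp (-s + (1 - 2 * n) * t) * y) = A * x * y := by
      intro x y w; rw [← hA]; ring
    have hB' : ∀ x y w : ℂ, cexp (-s + (2 * N + 1) * t) * (x * cexp (s + (1 + 2 * n) * t) * y) = B * x * y := by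
      intro x y w; rw [← hB]; ring
    rw [hA' _ _ 0, hB' _ _ 0]
    field_simp
    ring

lemma summable_ct_bound (σ : ℝ) {a : ℝ} (ha : a < 0) :
    Summable fun n : ℤ => ((n : ℝ) ^ 2 + 1) * Real.exp (n * σ + n ^ 2 * a) := by
  refine Summable.of_nonneg_of_le (fun n => by positivity) (fun n => ?_)
    ((summable_bound (a := a / 2) (by linarith)).mul_left (Real.exp (- σ ^ 2 / (2 * a))))
  rw [mul_left_comm, ← Real.exp_add]
  refine mul_le_mul_of_nonneg_left (Real.exp_le_exp.mpr ?_) (by positivity)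
  have h : - σ ^ 2 / (2 * a) + a / 2 * (n : ℝ) ^ 2 - (n * σ + n ^ 2 * a)
      = - (a / 2) * (n + σ / a) ^ 2 := by
    have : a ≠ 0 := ha.ne
    field_simp; ring
  nlinarith [mul_nonneg (by linarith : 0 ≤ -(a / 2)) (sq_nonneg ((n : ℝ) + σ / a))]

lemma norm_ct (s t : ℂ) (n : ℤ) : ‖ct s t n‖ = Real.exp (n * s.re + n ^ 2 * t.re) := by
  rw [ct, norm_mul, norm_zpow, norm_neg, norm_one, one_zpow, one_mul, Complex.norm_exp]
  congr 1
  have : ((n : ℂ) ^ 2) = (((n ^ 2 : ℤ) : ℝ) : ℂ) := by push_cast; rfl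
  rw [this, Complex.add_re, Complex.re_ofReal_mul, ← Complex.ofReal_intCast, Complex.re_ofReal_mul]
  push_cast; ring

/-- limit of finite identity, with linear weights -/
lemma limJ (s : ℂ) {t : ℂ} (ht : t.re < 0) (w : ℤ → ℂ) (hw : ∀ n : ℤ, ‖w n‖ ≤ (n : ℝ) ^ 2 + 1) :
    Tendsto (fun N : ℕ => ∑' n : ℤ, w n * ct s t n * BB (cexp (2 * t)) N n) atTop
      (𝓝 ((∑' n : ℤ, w n * ct s t n) * (Eu (cexp (2 * t)))⁻¹)) := by
  have hq : ‖cexp (2 * t)‖ < 1 := by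
    rw [Complex.norm_exp]; simp; linarith
  set q := cexp (2 * t) with hqd
  obtain ⟨M, hM⟩ := PP_bdd hq
  obtain ⟨M', hM0, hM'⟩ := rr_bdd hq
  rw [← tsum_mul_right]
  refine tendsto_tsum_of_dominated_convergence
    ((summable_ct_bound s.re ht).mul_left (M * (M' * M'))) ?_ ?_
  · intro n
    refine Tendsto.const_mul _ ?_
    have h1 : Tendsto (fun N : ℕ => PP q (2 * N)) atTop (𝓝 (Eu q)) :=
      (PP_tendsto hq).comp (tendsto_id.const_mul_atTop' (by norm_num))
    have h2 : Tendsto (fun N : ℕ => rr q ((N : ℤ) - n)) atTop (𝓝 (Eu q)⁻¹) :=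
      (rr_tendsto hq).comp (tendsto_atTop_add_const_right _ (-n) tendsto_natCast_atTop_atTop)
    have h3 : Tendsto (fun N : ℕ => rr q ((N : ℤ) + n)) atTop (𝓝 (Eu q)⁻¹) :=
      (rr_tendsto hq).comp (tendsto_atTop_add_const_right _ n tendsto_natCast_atTop_atTop)
    have h4 := h1.mul (h2.mul h3)
    rwa [mul_inv_cancel_left₀ (Eu_ne hq)] at h4
  · refine Eventually.of_forall fun N n => ?_
    rw [norm_mul, norm_mul, norm_ct, mul_comm (M * (M' * M'))]
    refine mul_le_mul (mul_le_mul_of_nonneg_right (hw n) (Real.exp_pos _).le) ?_ (norm_nonneg _)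
      (by positivity)
    rw [BB, norm_mul, norm_mul]
    have hM00 : 0 ≤ M := (norm_nonneg _).trans (hM 0)
    exact mul_le_mul (hM _) (mul_le_mul (hM' _) (hM' _) (norm_nonneg _) hM0) (by positivity) hM00

lemma prodN_tendsto (s : ℂ) {t : ℂ} (ht : t.re < 0) :
    Tendsto (prodN s t) atTop (𝓝 ((∑' n : ℤ, ct s t n) * (Eu (cexp (2 * t)))⁻¹)) := by
  have h := limJ s ht (fun _ => 1) (fun n => by simp; positivity)
  simp only [one_mul] at h
  refine h.congr fun N => ?_
  exact (finiteJ s ht N).tsum_eq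

lemma BB_zero (q : ℂ) (N : ℕ) (n : ℤ) (hn : n ∉ Finset.Icc (-(N : ℤ)) N) : BB q N n = 0 := by
  rw [Finset.mem_Icc, not_and_or] at hn
  rcases hn with h | h
  · have : rr q (N + n) = 0 := by rw [rr, if_pos (by omega)]
    simp [BB, this]
  · have : rr q (N - n) = 0 := by rw [rr, if_pos (by omega)]
    simp [BB, this]

lemma finiteJacobi {t : ℂ} (ht : t.re < 0) (N : ℕ) :
    ∑' n : ℤ, (n : ℂ) * ct t t n * BB (cexp (2 * t)) (N + 1) n =
      PP (cexp (2 * t)) (N + 1) * PP (cexp (2 * t)) N := by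
  set q := cexp (2 * t) with hqd
  have hfin : ∀ s : ℂ, prodN s t (N + 1) =
      ∑ n ∈ Finset.Icc (-((N + 1 : ℕ) : ℤ)) ((N + 1 : ℕ) : ℤ), ct s t n * BB q (N + 1) n := by
    intro s
    refine (finiteJ s ht (N + 1)).unique (hasSum_sum_of_ne_finset_zero fun n hn => ?_)
    rw [← hqd, BB_zero q (N + 1) n hn, mul_zero]
  have hd1 : HasDerivAt (fun s => prodN s t (N + 1))
      (∑ n ∈ Finset.Icc (-((N + 1 : ℕ) : ℤ)) ((N + 1 : ℕ) : ℤ), (n : ℂ) * ct t t n * BB q (N + 1) n) t := by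
    have : (fun s => prodN s t (N + 1)) = fun s => 
      ∑ n ∈ Finset.Icc (-((N + 1 : ℕ) : ℤ)) ((N + 1 : ℕ) : ℤ), ct s t n * BB q (N + 1) n := funext hfin
    rw [this]
    refine HasDerivAt.fun_sum fun n _ => ?_
    refine HasDerivAt.mul_const ?_ _
    have h := ((((hasDerivAt_id t).const_mul (n : ℂ)).add_const ((n : ℂ) ^ 2 * t)).cexp).const_mul
      ((-1 : ℂ) ^ n)
    refine h.congr_deriv ?_
    simp only [ct, id]; ring
  set G : ℂ → ℂ := fun s => (∏ k ∈ Finset.range N, ((1 - cexp (s + (2 * (k + 1 : ℕ) + 1) * t)) *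
    (1 - cexp (-s + (2 * (k + 1 : ℕ) + 1) * t)))) * (1 - cexp (s + t)) with hG
  have hd2 : HasDerivAt (fun s => prodN s t (N + 1)) (G t) t := by
    have : (fun s => prodN s t (N + 1)) = fun s => G s * (1 - cexp (-s + t)) := by
      funext s
      simp only [prodN, Finset.prod_range_succ', hG]
      simp
      ring
    rw [this]
    have hGd : DifferentiableAt ℂ G t := by
      simp only [hG]
      fun_prop
    have h1 : HasDerivAt (fun s : ℂ => 1 - cexp (-s + t)) 1 t := by
      have h := (((hasDerivAt_id t).neg.add_const t).cexp).const_sub 1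
      refine h.congr_deriv ?_
      simp
    have h2 := hGd.hasDerivAt.mul h1
    refine h2.congr_deriv ?_
    simp
  have h3 : ∑' n : ℤ, (n : ℂ) * ct t t n * BB q (N + 1) n = G t := by
    rw [tsum_eq_sum (s := Finset.Icc (-((N + 1 : ℕ) : ℤ)) ((N + 1 : ℕ) : ℤ))]
    · exact hd1.unique hd2
    · intro n hn; rw [BB_zero q (N + 1) n hn, mul_zero]
  rw [h3, hG]
  simp only [Finset.prod_mul_distrib]
  rw [PP, PP, Finset.prod_range_succ']
  have e1 : ∀ k : ℕ, cexp (t + (2 * (k + 1 : ℕ) + 1) * t) = q ^ (k + 1 + 1) := by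
    intro k; rw [hqd, ← Complex.exp_nat_mul]; congr 1; push_cast; ring
  have e2 : ∀ k : ℕ, cexp (-t + (2 * (k + 1 : ℕ) + 1) * t) = q ^ (k + 1) := by
    intro k; rw [hqd, ← Complex.exp_nat_mul]; congr 1; push_cast; ring
  have e3 : cexp (t + t) = q ^ (0 + 1) := by
    rw [hqd, ← Complex.exp_nat_mul]; congr 1; push_cast; ring
  simp only [e1, e2, e3]
  ring

lemma jacobi_aux {t : ℂ} (ht : t.re < 0) :
    ∑' n : ℤ, (n : ℂ) * ct t t n = Eu (cexp (2 * t)) ^ 3 := by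
  have hq : ‖cexp (2 * t)‖ < 1 := by
    rw [Complex.norm_exp]; simp; linarith
  have h := limJ t ht (fun n => (n : ℂ)) (fun n => by
    have h2 : ‖(n : ℂ)‖ = |(n : ℝ)| := by simp
    rw [h2, ← sq_abs]; nlinarith [sq_nonneg (|(n : ℝ)| - 1), abs_nonneg (n : ℝ)])
  have h1 := (tendsto_add_atTop_iff_nat 1).mpr h
  simp only [finiteJacobi ht] at h1
  have h2 := ((tendsto_add_atTop_iff_nat 1).mpr (PP_tendsto hq)).mul (PP_tendsto hq)
  have h3 := tendsto_nhds_unique h1 h2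
  have := Eu_ne hq
  field_simp at h3
  rw [h3]

end S19

namespace S19
open Complex Filter Topology

lemma qp_summable (a : ℂ) {q : ℂ} (hq : ‖q‖ < 1) : Summable fun k : ℕ => ‖-(a * q ^ k)‖ := by
  simpa using (summable_geometric_of_lt_one (norm_nonneg _) hq).mul_left ‖a‖

lemma qp_tendsto (a : ℂ) {q : ℂ} (hq : ‖q‖ < 1) :
    Tendsto (fun N => ∏ k ∈ Finset.range N, (1 - a * q ^ k)) atTop (𝓝 (qpoch a q)) := by
  have := (multipliable_one_add_of_summable (qp_summable a hq)).hasProd.tendsto_prod_nat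
  simpa [sub_eq_add_neg, qpoch] using this

lemma qp_ne {a q : ℂ} (ha : ‖a‖ < 1) (hq : ‖q‖ < 1) : qpoch a q ≠ 0 := by
  have := tprod_one_add_ne_zero_of_summable (f := fun k : ℕ => -(a * q ^ k)) (fun k => ?_)
    (qp_summable a hq)
  · simpa [qpoch, sub_eq_add_neg] using this
  · intro h
    have h1 : a * q ^ k = 1 := by linear_combination -h
    have h2 : ‖a‖ * ‖q‖ ^ k = 1 := by rw [← norm_pow, ← norm_mul, h1, norm_one]
    have h3 : ‖q‖ ^ k ≤ 1 := pow_le_one₀ (norm_nonneg _) hq.le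
    nlinarith [norm_nonneg a, norm_nonneg q]

lemma qp_shift (a : ℂ) {q : ℂ} (hq : ‖q‖ < 1) : qpoch a q = (1 - a) * qpoch (a * q) q := by
  have h1 := (tendsto_add_atTop_iff_nat 1).mpr (qp_tendsto a hq)
  have h2 := (qp_tendsto (a * q) hq).const_mul (1 - a)
  refine tendsto_nhds_unique h1 (h2.congr fun N => ?_)
  rw [Finset.prod_range_succ', mul_comm]
  congr 1
  · refine Finset.prod_congr rfl fun k _ => ?_
    ring
  · simp

lemma norm_pow_lt {q : ℂ} (hq : ‖q‖ < 1) {m : ℕ} (hm : 0 < m) : ‖q ^ m‖ < 1 := by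
  rw [norm_pow]; exact pow_lt_one₀ (norm_nonneg _) hq (by omega)

lemma qp_dissect (a : ℂ) {q : ℂ} (hq : ‖q‖ < 1) {m : ℕ} (hm : 0 < m) :
    qpoch a q = ∏ j ∈ Finset.range m, qpoch (a * q ^ j) (q ^ m) := by
  have h1 : Tendsto (fun N : ℕ => ∏ k ∈ Finset.range (m * N), (1 - a * q ^ k)) atTop (𝓝 (qpoch a q)) :=
    (qp_tendsto a hq).comp (tendsto_id.const_mul_atTop' hm)
  have h2 := tendsto_finsetProd (Finset.range m) fun j _ =>
    qp_tendsto (a * q ^ j) (norm_pow_lt hq hm)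
  refine tendsto_nhds_unique h1 (h2.congr fun N => ?_)
  rw [Finset.prod_comm]
  induction N with
  | zero => simp
  | succ N ih =>
    rw [Finset.prod_range_succ, ih, mul_add, mul_one, Finset.prod_range_add]
    congr 1
    refine Finset.prod_congr rfl fun j _ => ?_
    ring

lemma qp_mul_congr {ι : Type*} (s : Finset ι) (a : ι → ℂ) {q b q' : ℂ} (hq : ‖q‖ < 1) (hq' : ‖q'‖ < 1)
    (h : ∀ k : ℕ, ∏ i ∈ s, (1 - a i * q ^ k) = 1 - b * q' ^ k) :
    ∏ i ∈ s, qpoch (a i) q = qpoch b q' := by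
  have h2 := tendsto_finsetProd s fun i _ => qp_tendsto (a i) hq
  refine tendsto_nhds_unique (h2.congr fun N => ?_) (qp_tendsto b hq')
  rw [Finset.prod_comm]
  exact Finset.prod_congr rfl fun k _ => h k

lemma qp_neg (a : ℂ) {q : ℂ} (hq : ‖q‖ < 1) : qpoch a q * qpoch (-a) q = qpoch (a ^ 2) (q ^ 2) := by
  have := qp_mul_congr (Finset.range 2) (fun i => if i = 0 then a else -a) (b := a ^ 2)
    hq (norm_pow_lt hq (by norm_num : 0 < 2)) (fun k => by
      simp [Finset.prod_range_succ]; ring)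
  simpa [Finset.prod_range_succ] using this

lemma qp_five {z : ℂ} (hz5 : z ^ 5 = 1) (hz1 : 1 + z + z ^ 2 + z ^ 3 + z ^ 4 = 0)
    (a : ℂ) {q : ℂ} (hq : ‖q‖ < 1) :
    qpoch a q * qpoch (z * a) q * qpoch (z ^ 2 * a) q * qpoch (z ^ 3 * a) q * qpoch (z ^ 4 * a) q
      = qpoch (a ^ 5) (q ^ 5) := by
  have := qp_mul_congr (Finset.range 5) (fun i => z ^ i * a) (b := a ^ 5)
    hq (norm_pow_lt hq (by norm_num : 0 < 5)) (fun k => by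
      simp only [Finset.prod_range_succ, Finset.prod_range_zero, one_mul, pow_zero, pow_one]
      have : (1 - a * q ^ k) * (1 - z * a * q ^ k) * (1 - z ^ 2 * a * q ^ k) * (1 - z ^ 3 * a * q ^ k)
        * (1 - z ^ 4 * a * q ^ k) = 1 - (a * q ^ k) ^ 5 := by
        generalize hx : a * q ^ k = x
        have h4 : z ^ 4 = -1 - z - z ^ 2 - z ^ 3 := by linear_combination hz1
        simp only [mul_assoc, hx]
        grind
      rw [this]; ring)
  simpa [Finset.prod_range_succ] using this

lemma Eu_eq_qpoch (q : ℂ) : Eu q = qpoch q q := by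
  unfold Eu qpoch
  refine tprod_congr fun k => ?_
  rw [pow_succ']

lemma jtp (s : ℂ) {t : ℂ} (ht : t.re < 0) :
    ∑' n : ℤ, ct s t n = qpoch (cexp (s + t)) (cexp (2 * t)) * qpoch (cexp (-s + t)) (cexp (2 * t)) *
      qpoch (cexp (2 * t)) (cexp (2 * t)) := by
  have hq : ‖cexp (2 * t)‖ < 1 := by
    rw [Complex.norm_exp]; simp; linarith
  have h1 := prodN_tendsto s ht
  have h2 := (qp_tendsto (cexp (s + t)) hq).mul (qp_tendsto (cexp (-s + t)) hq)
  have h3 := tendsto_nhds_unique h1 (h2.congr fun N => ?_)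
  · rw [← h3, ← Eu_eq_qpoch, inv_mul_cancel_right₀ (Eu_ne hq)]
  · rw [← Finset.prod_mul_distrib, prodN]
    refine Finset.prod_congr rfl fun k _ => ?_
    rw [← Complex.exp_nat_mul, ← Complex.exp_add, ← Complex.exp_add]
    congr 3 <;> ring

lemma thetaProd {w : ℤ → ℂ} (a b : ℤ) (ha : a ≠ 0) {c κ : ℂ} (hc : c ≠ 0)
    (hsupp : ∀ n, w n ≠ 0 → ∃ m : ℤ, a * m + b = n)
    (hw : ∀ m : ℤ, w (a * m + b) = κ * ((-1) ^ m * c ^ m)) {t : ℂ} (ht : t.re < 0) :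
    T w t = κ * cexp t ^ (b ^ 2) *
      (qpoch (c * cexp t ^ (a ^ 2 + 2 * a * b)) (cexp t ^ (2 * a ^ 2)) *
       qpoch (c⁻¹ * cexp t ^ (a ^ 2 - 2 * a * b)) (cexp t ^ (2 * a ^ 2)) *
       qpoch (cexp t ^ (2 * a ^ 2)) (cexp t ^ (2 * a ^ 2))) := by
  have hinj : Function.Injective (fun m : ℤ => a * m + b) := by
    intro x y h
    simp only [add_left_inj] at h
    exact mul_left_cancel₀ ha h
  have h1 : T w t = ∑' m : ℤ, w (a * m + b) * cexp (t * ((a * m + b : ℤ) : ℂ) ^ 2) := by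
    rw [T, ← hinj.tsum_eq]
    intro n hn
    exact hsupp n (fun h => hn (by simp [h]))
  have ht' : (((a ^ 2 : ℤ) : ℂ) * t).re < 0 := by
    have : (0 : ℝ) < ((a ^ 2 : ℤ) : ℝ) := by exact_mod_cast sq_pos_of_ne_zero ha
    rw [← Complex.ofReal_intCast, Complex.re_ofReal_mul]
    nlinarith
  have h2 : T w t = κ * cexp t ^ (b ^ 2) *
      ∑' m : ℤ, ct (Complex.log c + ((2 * a * b : ℤ) : ℂ) * t) (((a ^ 2 : ℤ) : ℂ) * t) m := by
    rw [h1, ← tsum_mul_left]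
    refine tsum_congr fun m => ?_
    rw [hw, ct]
    have e1 : c ^ m = cexp (m * Complex.log c) := by
      rw [Complex.exp_int_mul, Complex.exp_log hc]
    rw [e1, ← Complex.exp_int_mul]
    have e2 : cexp (t * ((a * m + b : ℤ) : ℂ) ^ 2) * cexp (m * Complex.log c) =
      cexp (((b ^ 2 : ℤ) : ℂ) * t) * cexp (m * (Complex.log c + ((2 * a * b : ℤ) : ℂ) * t) +
        m ^ 2 * (((a ^ 2 : ℤ) : ℂ) * t)) := by
      rw [← Complex.exp_add, ← Complex.exp_add]; congr 1; push_cast; ring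
    linear_combination κ * (-1) ^ m * e2
  rw [h2, jtp _ ht']
  have e3 : cexp (2 * (((a ^ 2 : ℤ) : ℂ) * t)) = cexp t ^ (2 * a ^ 2) := by
    rw [← Complex.exp_int_mul]; congr 1; push_cast; ring
  have e4 : cexp (Complex.log c + ((2 * a * b : ℤ) : ℂ) * t + ((a ^ 2 : ℤ) : ℂ) * t) =
      c * cexp t ^ (a ^ 2 + 2 * a * b) := by
    rw [← Complex.exp_int_mul, add_assoc, Complex.exp_add, Complex.exp_log hc]
    congr 2; push_cast; ring
  have e5 : cexp (-(Complex.log c + ((2 * a * b : ℤ) : ℂ) * t) + ((a ^ 2 : ℤ) : ℂ) * t) =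
      c⁻¹ * cexp t ^ (a ^ 2 - 2 * a * b) := by
    rw [← Complex.exp_int_mul]
    rw [show -(Complex.log c + ((2 * a * b : ℤ) : ℂ) * t) + ((a ^ 2 : ℤ) : ℂ) * t =
      -Complex.log c + ((a ^ 2 - 2 * a * b : ℤ) : ℂ) * t by push_cast; ring]
    rw [Complex.exp_add, Complex.exp_neg, Complex.exp_log hc]
  rw [e3, e4, e5]

/-- sign character mod 4 -/
def ep (n : ℤ) : ℤ := if n % 4 = 1 then 1 else if n % 4 = 3 then -1 else 0

lemma ep_odd (m : ℤ) : (ep (2 * m + 1) : ℂ) = (-1) ^ m := by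
  rcases Int.even_or_odd m with h | h
  · rw [h.neg_one_zpow]
    obtain ⟨k, rfl⟩ := h
    rw [ep, if_pos (by omega)]; simp
  · rw [h.neg_one_zpow]
    obtain ⟨k, rfl⟩ := h
    rw [ep, if_neg (by omega), if_pos (by omega)]; simp

lemma ep_supp (n : ℤ) (h : (ep n : ℂ) ≠ 0) : ∃ m : ℤ, 2 * m + 1 = n := by
  refine ⟨n / 2, ?_⟩
  by_contra hn
  apply h
  rw [ep, if_neg (by omega), if_neg (by omega)]; simp

lemma ep_norm (n : ℤ) : ‖(ep n : ℂ)‖ ≤ 1 := by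
  unfold ep; split_ifs <;> simp

lemma neg_one_norm (n : ℤ) : ‖((-1 : ℂ)) ^ n‖ ≤ 1 := by simp

/-- Jacobi's identity -/
lemma K_eval {t : ℂ} (ht : t.re < 0) :
    T (fun n => (ep n : ℂ) * n) t = 2 * cexp t * qpoch (cexp t ^ 8) (cexp t ^ 8) ^ 3 := by
  have hinj : Function.Injective (fun m : ℤ => 2 * m + 1) := by
    intro x y h; simp only at h; omega
  have h1 : T (fun n => (ep n : ℂ) * n) t =
      ∑' m : ℤ, (ep (2 * m + 1) : ℂ) * ((2 * m + 1 : ℤ) : ℂ) * cexp (t * ((2 * m + 1 : ℤ) : ℂ) ^ 2) := by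
    rw [T, ← hinj.tsum_eq]
    intro n hn
    exact ep_supp n (fun h => hn (by simp [h]))
  have ht4 : (4 * t).re < 0 := by simp; linarith
  have hs : ∀ w : ℤ → ℂ, (∀ n : ℤ, ‖w n‖ ≤ (n : ℝ) ^ 2 + 1) →
      Summable fun n : ℤ => w n * ct (4 * t) (4 * t) n := by
    intro w hw
    refine Summable.of_norm_bounded (summable_ct_bound (4 * t).re ht4) fun n => ?_
    rw [norm_mul, norm_ct]
    exact mul_le_mul_of_nonneg_right (hw n) (Real.exp_pos _).le
  have hs1 := hs (fun n => (n : ℂ)) (fun n => by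
    have h2 : ‖(n : ℂ)‖ = |(n : ℝ)| := by simp
    rw [h2, ← sq_abs]; nlinarith [sq_nonneg (|(n : ℝ)| - 1), abs_nonneg (n : ℝ)])
  have hs0 := hs (fun n => 1) (fun n => by simp; positivity)
  have e8 : cexp (2 * (4 * t)) = cexp t ^ 8 := by
    rw [← Complex.exp_nat_mul]; congr 1; push_cast; ring
  have hJ := jacobi_aux ht4
  have hZ : ∑' n : ℤ, 1 * ct (4 * t) (4 * t) n = 0 := by
    simp only [one_mul]
    rw [jtp _ ht4]
    have hq : ‖cexp (2 * (4 * t))‖ < 1 := by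
      rw [Complex.norm_exp]; simp; linarith
    rw [qp_shift (cexp (-(4 * t) + 4 * t)) hq]
    simp
  have h2 : T (fun n => (ep n : ℂ) * n) t = cexp t * (2 * ∑' n : ℤ, (n : ℂ) * ct (4 * t) (4 * t) n +
      ∑' n : ℤ, 1 * ct (4 * t) (4 * t) n) := by
    rw [h1, ← tsum_mul_left, ← (hs1.mul_left 2).tsum_add hs0, ← tsum_mul_left]
    refine tsum_congr fun m => ?_
    rw [ep_odd, ct]
    have : cexp (t * ((2 * m + 1 : ℤ) : ℂ) ^ 2) = cexp t * cexp (m * (4 * t) + m ^ 2 * (4 * t)) := by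
      rw [← Complex.exp_add]; congr 1; push_cast; ring
    rw [this]; push_cast; ring
  rw [h2, hZ, hJ, e8, Eu_eq_qpoch]; ring

end S19

namespace S19
open Complex Filter Topology

/-- restriction of a weight to a residue class mod 5 -/
noncomputable def cw (w : ℤ → ℂ) (j : ℤ) (n : ℤ) : ℂ := if (n - j) % 5 = 0 then w n else 0

/-- twist of a weight -/
noncomputable def tw (w : ℤ → ℂ) (z : ℂ) (n : ℤ) : ℂ := w n * z ^ n

lemma Wt.cw {w : ℤ → ℂ} (hw : Wt w) (j : ℤ) : Wt (cw w j) := by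
  obtain ⟨C, hC⟩ := hw
  refine ⟨C, fun n => ?_⟩
  unfold S19.cw
  split_ifs
  · exact hC n
  · simpa using (norm_nonneg _).trans (hC n)

lemma Wt.tw {w : ℤ → ℂ} (hw : Wt w) {z : ℂ} (hz : ‖z‖ = 1) : Wt (tw w z) := by
  obtain ⟨C, hC⟩ := hw
  refine ⟨C, fun n => ?_⟩
  unfold S19.tw
  simpa [hz] using hC n

lemma lat_gen {t a : ℂ} {G : ℤ × ℤ → ℂ} (h : HasSum (fun x => (if (x.1 - 2 * x.2) % 5 = 0 then G x else 0) * E2 t x) a) :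
    HasSum (fun x => G (Lm x) * E2 (5 * t) x) a := by
  have := (Lm_inj.hasSum_iff (f := fun x => (if (x.1 - 2 * x.2) % 5 = 0 then G x else 0) * E2 t x) (a := a) ?_).2 h
  · refine this.congr_fun fun x => ?_
    simp only [Function.comp, E2_Lm]
    rw [if_pos]
    simp only [Lm]; omega
  · intro x hx
    rw [if_neg, zero_mul]
    exact fun h => hx (Lm_range x h)

lemma lat_cw {w w' : ℤ → ℂ} (hw : Wt w) (hw' : Wt w') {t : ℂ} (ht : t.re < 0) :
    HasSum (fun x => w (Lm x).1 * w' (Lm x).2 * E2 (5 * t) x)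
      (T (cw w 0) t * T (cw w' 0) t + T (cw w 2) t * T (cw w' 1) t + T (cw w 4) t * T (cw w' 2) t
        + T (cw w 1) t * T (cw w' 3) t + T (cw w 3) t * T (cw w' 4) t) := by
  apply lat_gen (G := fun x => w x.1 * w' x.2)
  have := ((((hasSum_mul (hw.cw 0) (hw'.cw 0) ht).add (hasSum_mul (hw.cw 2) (hw'.cw 1) ht)).add
    (hasSum_mul (hw.cw 4) (hw'.cw 2) ht)).add (hasSum_mul (hw.cw 1) (hw'.cw 3) ht)).add
    (hasSum_mul (hw.cw 3) (hw'.cw 4) ht)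
  refine this.congr_fun fun x => ?_
  obtain ⟨x, y⟩ := x
  simp only [cw]
  have h5 : (y % 5 = 0 ∨ y % 5 = 1 ∨ y % 5 = 2 ∨ y % 5 = 3 ∨ y % 5 = 4) := by omega
  have h6 : (x % 5 = 0 ∨ x % 5 = 1 ∨ x % 5 = 2 ∨ x % 5 = 3 ∨ x % 5 = 4) := by omega
  rcases h5 with h | h | h | h | h <;> rcases h6 with h' | h' | h' | h' | h' <;>
    simp [Int.sub_emod, Int.mul_emod, h, h']

lemma zeta_sum {z : ℂ} (hz5 : z ^ 5 = 1) (hz1 : 1 + z + z ^ 2 + z ^ 3 + z ^ 4 = 0) (n : ℤ) :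
    1 + z ^ n + (z ^ 2) ^ n + (z ^ 3) ^ n + (z ^ 4) ^ n = if n % 5 = 0 then 5 else 0 := by
  have hz : z ≠ 0 := by rintro rfl; simp at hz5
  have key : ∀ k : ℕ, (z ^ k) ^ n = (z ^ (n % 5)) ^ k := by
    intro k
    have h1 : z ^ n = z ^ (n % 5) := by
      conv_lhs => rw [← Int.emod_add_mul_ediv n 5]
      rw [zpow_add₀ hz, zpow_mul]
      rw [show z ^ (5 : ℤ) = 1 by exact_mod_cast hz5]; simp
    rw [← h1, ← zpow_natCast, ← zpow_natCast, ← zpow_mul, ← zpow_mul, mul_comm]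
  have k1 := key 1; rw [pow_one, pow_one] at k1
  rw [k1, key 2, key 3, key 4]
  have h5 : (n % 5 = 0 ∨ n % 5 = 1 ∨ n % 5 = 2 ∨ n % 5 = 3 ∨ n % 5 = 4) := by omega
  rcases h5 with h | h | h | h | h <;> rw [h]
  · norm_num
  · simp; linear_combination hz1
  · rw [show z ^ (2 : ℤ) = z ^ 2 by exact_mod_cast zpow_natCast z 2]; simp
    linear_combination hz1 + (z + z ^ 3) * hz5
  · rw [show z ^ (3 : ℤ) = z ^ 3 by exact_mod_cast zpow_natCast z 3]; simp
    linear_combination hz1 + (z + z ^ 4 + z ^ 2 + z ^ 7) * hz5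
  · rw [show z ^ (4 : ℤ) = z ^ 4 by exact_mod_cast zpow_natCast z 4]; simp
    linear_combination hz1 + (z ^ 3 + z ^ 7 + z ^ 2 + z ^ 11 + z ^ 6 + z) * hz5

lemma lat_tw {w w' : ℤ → ℂ} (hw : Wt w) (hw' : Wt w') {t : ℂ} (ht : t.re < 0)
    {z : ℂ} (hz5 : z ^ 5 = 1) (hz1 : 1 + z + z ^ 2 + z ^ 3 + z ^ 4 = 0) :
    HasSum (fun x => 5 * (w (Lm x).1 * w' (Lm x).2) * E2 (5 * t) x)
      (T w t * T w' t + T (tw w z) t * T (tw w' (z ^ 3)) t + T (tw w (z ^ 2)) t * T (tw w' z) t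
        + T (tw w (z ^ 3)) t * T (tw w' (z ^ 4)) t + T (tw w (z ^ 4)) t * T (tw w' (z ^ 2)) t) := by
  have hz : z ≠ 0 := by rintro rfl; simp at hz5
  have hn : ‖z‖ = 1 := by
    have : ‖z‖ ^ 5 = 1 := by rw [← norm_pow, hz5, norm_one]
    exact (pow_eq_one_iff_of_nonneg (norm_nonneg _) (by norm_num)).1 this
  have hnk : ∀ k : ℕ, ‖z ^ k‖ = 1 := fun k => by rw [norm_pow, hn, one_pow]
  apply lat_gen (G := fun x => 5 * (w x.1 * w' x.2))
  have := ((((hasSum_mul hw hw' ht).add (hasSum_mul (hw.tw hn) (hw'.tw (hnk 3)) ht)).add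
    (hasSum_mul (hw.tw (hnk 2)) (hw'.tw hn) ht)).add (hasSum_mul (hw.tw (hnk 3)) (hw'.tw (hnk 4)) ht)).add
    (hasSum_mul (hw.tw (hnk 4)) (hw'.tw (hnk 2)) ht)
  refine this.congr_fun fun x => ?_
  obtain ⟨x, y⟩ := x
  simp only [tw]
  have hs := zeta_sum hz5 hz1 (x - 2 * y)
  have e : ∀ (a b : ℕ) (c : ℤ), (b : ℤ) = 5 * c - 2 * a → (z ^ a) ^ (x - 2 * y) = (z ^ a) ^ x * (z ^ b) ^ y := by
    intro a b c h
    simp only [← zpow_natCast, ← zpow_mul, ← zpow_add₀ hz]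
    have : z ^ (5 * (c * y)) = 1 := by rw [zpow_mul, show z ^ (5 : ℤ) = 1 by exact_mod_cast hz5, one_zpow]
    rw [show (a : ℤ) * x + b * y = a * (x - 2 * y) + 5 * (c * y) by rw [h]; ring, zpow_add₀ hz, this, mul_one]
  have e1 := e 1 3 1 (by norm_num)
  have e2 := e 2 1 1 (by norm_num)
  have e3 := e 3 4 2 (by norm_num)
  have e4 := e 4 2 2 (by norm_num)
  simp only [pow_one] at e1 e2
  rw [e1, e2, e3, e4] at hs
  have : (if (x - 2 * y) % 5 = 0 then 5 * (w x * w' y) else 0) =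
    (if (x - 2 * y) % 5 = 0 then 5 else 0) * (w x * w' y) := by split_ifs <;> simp
  rw [this, ← hs]; ring

lemma T_neg {w w' : ℤ → ℂ} (κ : ℂ) (h : ∀ n, w (-n) = κ * w' n) (t : ℂ) : T w t = κ * T w' t := by
  unfold T
  rw [← (Equiv.neg ℤ).tsum_eq, ← tsum_mul_left]
  refine tsum_congr fun n => ?_
  simp only [Equiv.neg_apply, h]; push_cast; ring_nf

end S19

namespace S19
open Complex Filter Topology

/-- Euler product -/
noncomputable def ff (q : ℂ) : ℂ := qpoch q q

lemma ff_ne {q : ℂ} (hq : ‖q‖ < 1) : ff q ≠ 0 := qp_ne hq hq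

lemma ff_dissect {q : ℂ} (hq : ‖q‖ < 1) : ff q = qpoch q (q ^ 2) * ff (q ^ 2) := by
  unfold ff
  rw [qp_dissect q hq (m := 2) (by norm_num)]
  simp [Finset.prod_range_succ, ← pow_succ', ← pow_two]

lemma phi_eq {q : ℂ} (hq : ‖q‖ < 1) : phiNeg q = qpoch q (q ^ 2) ^ 2 * ff (q ^ 2) := by
  have h := ff_ne (norm_pow_lt hq (m := 2) (by norm_num))
  have h2 := ff_dissect hq
  unfold phiNeg
  change ff q ^ 2 / ff (q ^ 2) = _
  rw [h2]; field_simp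

/-- sign weight -/
noncomputable def sg (n : ℤ) : ℂ := (-1) ^ n

lemma sg_wt : Wt sg := Wt.of_bdd 1 neg_one_norm

lemma T_sg {t : ℂ} (ht : t.re < 0) : T sg t = phiNeg (cexp t) := by
  have hp : ‖cexp t‖ < 1 := by rw [Complex.norm_exp]; simpa using ht
  rw [thetaProd (w := sg) 1 0 one_ne_zero (c := 1) (κ := 1) one_ne_zero
    (fun n _ => ⟨n, by ring⟩) (fun m => by simp [sg]) ht, phi_eq hp]
  norm_num [zpow_ofNat, ff]
  left; ring

lemma exp_norm {t : ℂ} (ht : t.re < 0) : ‖cexp t‖ < 1 := by rw [Complex.norm_exp]; simpa using ht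

lemma exists_exp {q : ℂ} (h0 : q ≠ 0) (hq : ‖q‖ < 1) {m : ℕ} (hm : 0 < m) : ∃ t : ℂ, t.re < 0 ∧ cexp t ^ m = q := by
  have hm' : (0 : ℝ) < m := by exact_mod_cast hm
  refine ⟨Complex.log q / m, ?_, ?_⟩
  · rw [Complex.div_natCast_re, Complex.log_re]
    exact div_neg_of_neg_of_pos (Real.log_neg (norm_pos_iff.2 h0) hq) hm'
  · rw [← Complex.exp_nat_mul, mul_div_cancel₀, Complex.exp_log h0]
    exact_mod_cast hm.ne'

lemma five_re {t : ℂ} (ht : t.re < 0) : (5 * t).re < 0 := by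
  have : (5 * t).re = 5 * t.re := by simp
  linarith

lemma sg_Lm (x : ℤ × ℤ) : sg (Lm x).1 * sg (Lm x).2 = sg x.1 * sg x.2 := by
  simp only [sg, Lm]
  rw [← zpow_add₀ (by norm_num), ← zpow_add₀ (by norm_num)]
  rw [show 2 * x.1 - x.2 + (x.1 + 2 * x.2) = (x.1 + x.2) + 2 * x.1 by ring, zpow_add₀ (by norm_num), zpow_mul]
  norm_num

lemma sg_mul (a m b : ℤ) (ha : Odd a) : sg (a * m + b) = (-1) ^ b * (-1) ^ m := by
  simp only [sg]
  rw [zpow_add₀ (by norm_num), zpow_mul, ha.neg_one_zpow, mul_comm]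

lemma sg_neg (n : ℤ) : sg (-n) = sg n := by
  simp only [sg]; rw [zpow_neg, ← inv_zpow]; norm_num

lemma cw_supp {w : ℤ → ℂ} {b j : ℤ} (hb : (b - j) % 5 = 0) (n : ℤ) (h : cw w j n ≠ 0) : ∃ m : ℤ, 5 * m + b = n := by
  unfold cw at h
  split_ifs at h with h1
  · exact ⟨(n - b) / 5, by omega⟩
  · exact absurd rfl h

lemma cw_app {w : ℤ → ℂ} {b j : ℤ} (hb : (b - j) % 5 = 0) (m : ℤ) : cw w j (5 * m + b) = w (5 * m + b) := by
  unfold cw; rw [if_pos (by omega)]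

lemma T_sg_sq {t : ℂ} (ht : t.re < 0) :
    HasSum (fun x => sg (Lm x).1 * sg (Lm x).2 * E2 (5 * t) x) (T sg (5 * t) ^ 2) := by
  rw [pow_two]
  refine (hasSum_mul sg_wt sg_wt (five_re ht)).congr_fun fun x => ?_
  rw [sg_Lm]

lemma exp_five (t : ℂ) : cexp (5 * t) = cexp t ^ 5 := by
  rw [← Complex.exp_nat_mul]; norm_num

lemma identI {q : ℂ} (h0 : q ≠ 0) (hq : ‖q‖ < 1) :
    (phiNeg (q ^ 5) ^ 2 - phiNeg q ^ 2) * (ff (q ^ 2) * ff (q ^ 5)) = 4 * q * ff q * ff (q ^ 10) ^ 3 := by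
  obtain ⟨t, ht, hqt⟩ := exists_exp h0 hq (m := 5) (by norm_num)
  have hp := exp_norm ht
  have key := (T_sg_sq ht).unique (lat_cw sg_wt sg_wt ht)
  have s4 : T (cw sg 4) t = T (cw sg 1) t := by
    rw [T_neg (w := cw sg 4) (w' := cw sg 1) 1 (fun n => ?_), one_mul]
    rw [one_mul]; unfold cw; rw [sg_neg]
    congr 1; simp only [eq_iff_iff]; omega
  have s3 : T (cw sg 3) t = T (cw sg 2) t := by
    rw [T_neg (w := cw sg 3) (w' := cw sg 2) 1 (fun n => ?_), one_mul]
    rw [one_mul]; unfold cw; rw [sg_neg]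
    congr 1; simp only [eq_iff_iff]; omega
  have v0 := thetaProd (w := cw sg 0) 5 0 (by norm_num) (c := 1) (κ := 1) one_ne_zero
    (cw_supp (by norm_num)) (fun m => by rw [cw_app (by norm_num), sg_mul _ _ _ (by decide)]; simp) ht
  have v1 := thetaProd (w := cw sg 1) 5 1 (by norm_num) (c := 1) (κ := -1) one_ne_zero
    (cw_supp (by norm_num)) (fun m => by rw [cw_app (by norm_num), sg_mul _ _ _ (by decide)]; simp) ht
  have v2 := thetaProd (w := cw sg 2) 5 2 (by norm_num) (c := 1) (κ := 1) one_ne_zero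
    (cw_supp (by norm_num)) (fun m => by rw [cw_app (by norm_num), sg_mul _ _ _ (by decide)]; simp) ht
  rw [s4, s3, T_sg (five_re ht), exp_five, hqt] at key
  norm_num [zpow_ofNat] at v0 v1 v2
  have e : ∀ k, cexp t ^ (5 * k) = q ^ k := fun k => by rw [pow_mul, hqt]
  have e5 := e 1; have e15 := e 3; have e35 := e 7; have e25 := e 5; have e45 := e 9; have e50 := e 10
  norm_num at e5 e15 e35 e25 e45 e50
  rw [e25, e50] at v0
  rw [e35, e15, e50] at v1
  rw [e45, e5, e50] at v2
  have w0 : T (cw sg 0) t = phiNeg (q ^ 5) := by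
    rw [v0, phi_eq (norm_pow_lt hq (by norm_num)), ff, ← pow_mul]; ring
  rw [w0, v1, v2] at key
  have hd := qp_dissect q (norm_pow_lt hq (m := 2) (by norm_num)) (m := 5) (by norm_num)
  simp only [Finset.prod_range_succ, Finset.prod_range_zero, ← pow_mul] at hd
  norm_num [← pow_succ'] at hd
  rw [ff_dissect hq, ff_dissect (norm_pow_lt hq (m := 5) (by norm_num)), ← pow_mul, hd]
  have h4 : cexp t * cexp t ^ 4 = q := by rw [← pow_succ']; exact hqt
  simp only [ff]
  norm_num
  linear_combination (-(qpoch (q ^ 2) (q ^ 2) * qpoch (q ^ 5) (q ^ 10) * qpoch (q ^ 10) (q ^ 10))) * key +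
    4 * (qpoch (q ^ 2) (q ^ 2) * qpoch (q ^ 5) (q ^ 10) * qpoch (q ^ 10) (q ^ 10) ^ 3 * qpoch (q ^ 9) (q ^ 10) *
    qpoch q (q ^ 10) * qpoch (q ^ 7) (q ^ 10) * qpoch (q ^ 3) (q ^ 10)) * h4

/-- primitive fifth root -/
lemma exists_zeta : ∃ z : ℂ, z ^ 5 = 1 ∧ 1 + z + z ^ 2 + z ^ 3 + z ^ 4 = 0 := by
  have h := Complex.isPrimitiveRoot_exp 5 (by norm_num)
  refine ⟨_, h.pow_eq_one, ?_⟩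
  have := h.geom_sum_eq_zero (by norm_num)
  simpa [Finset.sum_range_succ] using this

lemma T_tw_neg {w : ℤ → ℂ} (κ : ℂ) (h : ∀ n, w (-n) = κ * w n) {z z' : ℂ} (hz : z * z' = 1) (t : ℂ) :
    T (tw w z) t = κ * T (tw w z') t := by
  apply T_neg
  intro n
  simp only [tw]
  rw [h, eq_inv_of_mul_eq_one_left hz]; simp; ring

lemma identII {q : ℂ} (h0 : q ≠ 0) (hq : ‖q‖ < 1) :
    (5 * phiNeg (q ^ 5) ^ 2 - phiNeg q ^ 2) * (ff q * ff (q ^ 10)) = 4 * ff (q ^ 5) * ff (q ^ 2) ^ 3 := by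
  obtain ⟨t, ht, hqt⟩ := exists_exp h0 hq (m := 1) (by norm_num)
  rw [pow_one] at hqt
  obtain ⟨z, hz5, hz1⟩ := exists_zeta
  have hz : z ≠ 0 := by rintro rfl; simp at hz5
  have key := (T_sg_sq ht).mul_left 5 |>.unique
    ((lat_tw sg_wt sg_wt ht hz5 hz1).congr_fun fun x => by ring)
  rw [T_tw_neg (z := z ^ 4) (z' := z) 1 (fun n => by rw [sg_neg, one_mul]) (by rw [← pow_succ]; exact hz5),
    T_tw_neg (z := z ^ 3) (z' := z ^ 2) 1 (fun n => by rw [sg_neg, one_mul]) (by rw [← pow_add]; exact hz5),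
    T_sg ht, T_sg (five_re ht), exp_five, hqt] at key
  have v1 := thetaProd (w := tw sg z) 1 0 one_ne_zero (c := z) (κ := 1) hz
    (fun n _ => ⟨n, by ring⟩) (fun m => by simp [tw, sg]) ht
  have v2 := thetaProd (w := tw sg (z ^ 2)) 1 0 one_ne_zero (c := z ^ 2) (κ := 1) (pow_ne_zero 2 hz)
    (fun n _ => ⟨n, by ring⟩) (fun m => by simp [tw, sg]) ht
  have i1 : z⁻¹ = z ^ 4 := inv_eq_of_mul_eq_one_right (by rw [← pow_succ']; exact hz5)
  have i2 : (z ^ 2)⁻¹ = z ^ 3 := inv_eq_of_mul_eq_one_right (by rw [← pow_add]; exact hz5)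
  rw [i1] at v1
  rw [i2] at v2
  norm_num [zpow_ofNat, hqt] at v1 v2
  have h5 := qp_five hz5 hz1 q (norm_pow_lt hq (m := 2) (by norm_num))
  rw [← pow_mul] at h5
  rw [v1, v2] at key
  rw [ff_dissect hq, ff_dissect (norm_pow_lt hq (m := 5) (by norm_num)), ← pow_mul, ← h5]
  simp only [ff]
  norm_num
  linear_combination (qpoch (q ^ 2) (q ^ 2) * qpoch q (q ^ 2) * qpoch (q ^ 10) (q ^ 10)) * key

end S19

namespace S19
open Complex Filter Topology

/-- complex-valued character mod 4 -/
noncomputable def ec (n : ℤ) : ℂ := (ep n : ℂ)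
/-- quadratic weight -/
noncomputable def ec2 (n : ℤ) : ℂ := ec n * (n : ℂ) ^ 2
/-- linear weight -/
noncomputable def ec1 (n : ℤ) : ℂ := ec n * (n : ℂ)

lemma ec_wt : Wt ec := Wt.of_bdd 1 ep_norm
lemma ec1_wt : Wt ec1 := Wt.lin_of_bdd 1 ep_norm
lemma ec2_wt : Wt ec2 := Wt.sq_of_bdd 1 ep_norm

lemma ep_neg (n : ℤ) : ep (-n) = - ep n := by
  unfold ep; split_ifs <;> omega

lemma ec_neg (n : ℤ) : ec (-n) = -1 * ec n := by
  unfold ec; rw [ep_neg]; simp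

lemma ec2_neg (n : ℤ) : ec2 (-n) = -1 * ec2 n := by
  unfold ec2; rw [ec_neg]; push_cast; ring

lemma ec_Lm (x : ℤ × ℤ) : ec (Lm x).1 * ec (Lm x).2 = - (ec x.1 * ec x.2) := by
  have : ep (Lm x).1 * ep (Lm x).2 = - (ep x.1 * ep x.2) := by
    obtain ⟨u, v⟩ := x
    simp only [Lm]
    have h5 : (u % 4 = 0 ∨ u % 4 = 1 ∨ u % 4 = 2 ∨ u % 4 = 3) := by omega
    have h6 : (v % 4 = 0 ∨ v % 4 = 1 ∨ v % 4 = 2 ∨ v % 4 = 3) := by omega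
    rcases h5 with h | h | h | h <;> rcases h6 with h' | h' | h' | h' <;>
      simp [ep, Int.sub_emod, Int.add_emod, Int.mul_emod, h, h']
  unfold ec
  exact_mod_cast this

lemma W_side {t a b : ℂ} (ht : t.re < 0)
    (h1 : HasSum (fun x => ec2 (Lm x).1 * ec (Lm x).2 * E2 (5 * t) x) a)
    (h2 : HasSum (fun x => ec (Lm x).1 * ec2 (Lm x).2 * E2 (5 * t) x) b) :
    a - b = 8 * T ec1 (5 * t) ^ 2 := by
  have h5 := five_re ht
  have h := (((hasSum_mul ec1_wt ec1_wt h5).mul_left 8).add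
    ((hasSum_mul ec_wt ec2_wt h5).mul_left 3)).sub ((hasSum_mul ec2_wt ec_wt h5).mul_left 3)
  have hh := (h1.sub h2).unique (h.congr_fun fun x => ?_)
  · rw [hh]; ring
  · have e := ec_Lm x
    simp only [ec1, ec2]
    simp only [Lm] at e ⊢
    push_cast
    linear_combination E2 (5 * t) x * (3 * (x.1 : ℂ) ^ 2 - 8 * x.1 * x.2 - 3 * (x.2 : ℂ) ^ 2) * e

lemma W_cw {t : ℂ} (ht : t.re < 0) :
    T (cw ec2 2) t * T (cw ec 1) t - T (cw ec 2) t * T (cw ec2 1) t = 2 * T ec1 (5 * t) ^ 2 := by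
  have h := W_side ht (lat_cw ec2_wt ec_wt ht) (lat_cw ec_wt ec2_wt ht)
  have s : ∀ (w : ℤ → ℂ) (hw : ∀ n, w (-n) = -1 * w n) (i j : ℤ), (i + j) % 5 = 0 → T (cw w i) t = -1 * T (cw w j) t := by
    intro w hw i j hij
    apply T_neg
    intro n
    unfold cw; rw [hw, mul_ite, mul_zero]
    congr 1; simp only [eq_iff_iff]; omega
  rw [s ec ec_neg 3 2 (by norm_num), s ec ec_neg 4 1 (by norm_num),
    s ec2 ec2_neg 3 2 (by norm_num), s ec2 ec2_neg 4 1 (by norm_num)] at h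
  have s0 := s ec ec_neg 0 0 (by norm_num)
  linear_combination h / 4

lemma W_tw {t : ℂ} (ht : t.re < 0) {z : ℂ} (hz5 : z ^ 5 = 1) (hz1 : 1 + z + z ^ 2 + z ^ 3 + z ^ 4 = 0) :
    T (tw ec2 z) t * T (tw ec (z ^ 2)) t - T (tw ec z) t * T (tw ec2 (z ^ 2)) t = -10 * T ec1 (5 * t) ^ 2 := by
  have h := W_side ht (((lat_tw ec2_wt ec_wt ht hz5 hz1).mul_left (1 / 5)).congr_fun fun x => by ring)
    (((lat_tw ec_wt ec2_wt ht hz5 hz1).mul_left (1 / 5)).congr_fun fun x => by ring)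
  rw [T_tw_neg (w := ec) (z := z ^ 4) (z' := z) (-1) ec_neg (by rw [← pow_succ]; exact hz5),
    T_tw_neg (w := ec2) (z := z ^ 4) (z' := z) (-1) ec2_neg (by rw [← pow_succ]; exact hz5),
    T_tw_neg (w := ec) (z := z ^ 3) (z' := z ^ 2) (-1) ec_neg (by rw [← pow_add]; exact hz5),
    T_tw_neg (w := ec2) (z := z ^ 3) (z' := z ^ 2) (-1) ec2_neg (by rw [← pow_add]; exact hz5)] at h
  linear_combination (-5 / 4) * h

lemma T_ec1 {t : ℂ} (ht : t.re < 0) : T ec1 t = 2 * cexp t * ff (cexp t ^ 8) ^ 3 := K_eval ht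

end S19

namespace S19
open Complex Filter Topology

/-- logarithmic derivative of a q-Pochhammer symbol -/
lemma qp_deriv {c : ℂ} (hc : ‖c‖ ≤ 1) {lam al be : ℕ} (hl : 0 < lam) (hal : 0 < al) (hbe : 0 < be)
    {t : ℂ} (ht : t.re < 0) :
    HasDerivAt (fun s => qpoch (c * (cexp s ^ lam) ^ be) ((cexp s ^ lam) ^ al))
      (qpoch (c * (cexp t ^ lam) ^ be) ((cexp t ^ lam) ^ al) *
        (-(lam : ℂ) * ∑' k : ℕ, ((al * k + be : ℕ) : ℂ) * (c * (cexp t ^ lam) ^ (al * k + be)) /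
          (1 - c * (cexp t ^ lam) ^ (al * k + be)))) t := by
  set s : Set ℂ := {x | x.re < t.re / 2} with hs
  have hso : IsOpen s := isOpen_lt Complex.continuous_re continuous_const
  have hts : t ∈ s := by simp only [hs, Set.mem_ofPred_eq]; linarith
  set f : ℕ → ℂ → ℂ := fun k x => -(c * (cexp x ^ lam) ^ (al * k + be)) with hf
  have hfun : (fun x => qpoch (c * (cexp x ^ lam) ^ be) ((cexp x ^ lam) ^ al)) =
      fun x => ∏' k : ℕ, (1 + f k x) := by
    funext x
    unfold qpoch
    refine tprod_congr fun k => ?_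
    simp only [hf]; ring
  set ρ : ℝ := Real.exp (t.re / 2) with hρ
  have hρ1 : ρ < 1 := by rw [hρ]; simp; linarith
  have hρ0 : 0 < ρ := Real.exp_pos _
  have hpow : ∀ x ∈ s, ∀ k, ‖f k x‖ ≤ ρ ^ (k + 1) := by
    intro x hx k
    simp only [hf, norm_neg, norm_mul, norm_pow, Complex.norm_exp]
    have h1 : Real.exp x.re ≤ ρ := Real.exp_le_exp.2 (le_of_lt hx)
    have h2 : (Real.exp x.re ^ lam) ^ (al * k + be) ≤ ρ ^ (k + 1) := by
      rw [← pow_mul]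
      refine (pow_le_pow_left₀ (Real.exp_pos _).le h1 _).trans (pow_le_pow_of_le_one hρ0.le hρ1.le ?_)
      nlinarith [Nat.mul_le_mul hl hal, Nat.mul_le_mul_right k (Nat.mul_le_mul hl hal), Nat.mul_le_mul hl hbe]
    calc _ ≤ 1 * ρ ^ (k + 1) := mul_le_mul hc h2 (by positivity) zero_le_one
      _ = _ := one_mul _
  have hsum : Summable fun k : ℕ => ρ ^ (k + 1) :=
    (summable_nat_add_iff 1).2 (summable_geometric_of_lt_one hρ0.le hρ1)
  have hd : ∀ k, Differentiable ℂ (f k) := fun k => by simp only [hf]; fun_prop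
  have hprod := Summable.hasProdLocallyUniformlyOn_nat_one_add hso hsum
    (Eventually.of_forall fun n x hx => hpow x hx n) (fun n => (hd n).continuous.continuousOn)
  have hdiff : DifferentiableAt ℂ (fun x => ∏' k : ℕ, (1 + f k x)) t := by
    have := TendstoLocallyUniformlyOn.differentiableOn (hprod : TendstoLocallyUniformlyOn _ _ _ _)
      (Eventually.of_forall fun n => by
        refine DifferentiableOn.fun_finsetProd fun i _ => ?_
        exact ((hd i).const_add 1).differentiableOn) hso
    exact this.differentiableAt (hso.mem_nhds hts)
  have hq : ‖cexp t ^ lam‖ < 1 := norm_pow_lt (exp_norm ht) hl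
  have hne : ∏' k : ℕ, (1 + f k t) ≠ 0 := by
    have := congrFun hfun t
    rw [← this]
    refine qp_ne ?_ (norm_pow_lt hq hal)
    rw [norm_mul]
    have := norm_pow_lt hq hbe
    nlinarith [norm_nonneg c, norm_nonneg ((cexp t ^ lam) ^ be)]
  have hlt : ∀ k, ‖f k t‖ < 1 := fun k => (hpow t hts k).trans_lt (pow_lt_one₀ hρ0.le hρ1 (by omega))
  have hfne : ∀ k, 1 + f k t ≠ 0 := by
    intro k h
    have h2 : f k t = -1 := by linear_combination h
    have := hlt k
    rw [h2] at this; simp at this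
  have hder : ∀ k, HasDerivAt (fun x => 1 + f k x) ((lam * (al * k + be) : ℕ) * f k t) t := by
    intro k
    have hfk : f k = fun x => -(c * cexp (((lam * (al * k + be) : ℕ) : ℂ) * x)) := by
      funext x
      simp only [hf]
      rw [← pow_mul, ← Complex.exp_nat_mul]
    rw [hfk]
    have h1 : HasDerivAt (fun x : ℂ => ((lam * (al * k + be) : ℕ) : ℂ) * x) ((lam * (al * k + be) : ℕ) : ℂ) t := by
      simpa using (hasDerivAt_id t).const_mul ((lam * (al * k + be) : ℕ) : ℂ)
    have := (((h1.cexp).const_mul c).neg).const_add 1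
    refine this.congr_deriv ?_
    ring
  have hlog : ∀ k, logDeriv (fun x => 1 + f k x) t = -(lam : ℂ) * (((al * k + be : ℕ) : ℂ) * (c * (cexp t ^ lam) ^ (al * k + be)) /
          (1 - c * (cexp t ^ lam) ^ (al * k + be))) := by
    intro k
    rw [logDeriv_apply, (hder k).deriv]
    simp only [hf]
    push_cast
    rw [← sub_eq_add_neg]
    ring
  have hls : Summable fun k => logDeriv (fun x => 1 + f k x) t := by
    have hb : Summable fun k : ℕ => ((lam * (al * k + be) : ℕ) : ℝ) * ρ ^ (k + 1) / (1 - ρ) := by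
      have g1 := (summable_pow_mul_geometric_of_norm_lt_one 1 (r := ρ) (by rw [Real.norm_of_nonneg hρ0.le]; exact hρ1)).mul_left ((lam * al : ℕ) * ρ / (1 - ρ) : ℝ)
      have g2 := (summable_geometric_of_lt_one hρ0.le hρ1).mul_left ((lam * be : ℕ) * ρ / (1 - ρ) : ℝ)
      refine (g1.add g2).congr fun k => ?_
      push_cast; ring
    refine Summable.of_norm_bounded hb fun k => ?_
    rw [logDeriv_apply, (hder k).deriv, norm_div, norm_mul, Complex.norm_natCast]
    have h1ρ : 0 < 1 - ρ := by linarith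
    have hk1 : ρ ^ (k + 1) ≤ ρ := by
      calc ρ ^ (k + 1) ≤ ρ ^ 1 := pow_le_pow_of_le_one hρ0.le hρ1.le (by omega)
        _ = ρ := pow_one _
    have hden : 1 - ρ ≤ ‖1 + f k t‖ := by
      have := norm_sub_norm_le (1 : ℂ) (-(f k t))
      rw [norm_neg, norm_one, sub_neg_eq_add] at this
      have := hpow t hts k
      linarith
    exact div_le_div₀ (by positivity) (mul_le_mul_of_nonneg_left (hpow t hts k) (by positivity)) h1ρ hden
  have hmain := logDeriv_tprod_eq_tsum hso hts (f := fun k x => 1 + f k x) hfne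
    (fun i => ((hd i).const_add 1).differentiableOn) hls ⟨_, hprod⟩ hne
  have hval : qpoch (c * (cexp t ^ lam) ^ be) ((cexp t ^ lam) ^ al) = ∏' k : ℕ, (1 + f k t) := congrFun hfun t
  rw [hfun, hval]
  have hD := hdiff.hasDerivAt
  rw [logDeriv_apply, div_eq_iff hne] at hmain
  rw [hmain] at hD
  rw [tsum_congr hlog, tsum_mul_left, mul_comm] at hD
  exact hD

/-- Lambert type double series -/
noncomputable def Lam (w : ℕ → ℕ → ℂ) (q : ℂ) : ℂ :=
  ∑' x : ℕ+ × ℕ+, w x.1 x.2 * (x.1 : ℕ) * q ^ ((x.1 : ℕ) * x.2)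

lemma Lam_summable {w : ℕ → ℕ → ℂ} {C : ℝ} (hw : ∀ n l, ‖w n l‖ ≤ C) {q : ℂ} (hq : ‖q‖ < 1) :
    Summable fun x : ℕ+ × ℕ+ => w x.1 x.2 * (x.1 : ℕ) * q ^ ((x.1 : ℕ) * x.2) := by
  have h := (Equiv.prodComm ℕ+ ℕ+).summable_iff.2 (summable_prod_mul_pow (𝕜 := ℝ) 1 (r := ‖q‖) (by simpa using hq))
  refine Summable.of_norm_bounded (h.mul_left C) fun x => ?_
  simp only [norm_mul, norm_pow, Complex.norm_natCast, Function.comp, Equiv.prodComm_apply, Prod.swap, pow_one]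
  rw [mul_assoc, mul_comm (x.2 : ℕ)]
  exact mul_le_mul_of_nonneg_right (hw _ _) (by positivity)

lemma Lam_eval {c : ℂ} (hc : ‖c‖ ≤ 1) {al be : ℕ} (hal : 0 < al) (hbe : 0 < be) (hab : be ≤ al)
    {q : ℂ} (hq : ‖q‖ < 1) :
    ∑' k : ℕ, ((al * k + be : ℕ) : ℂ) * (c * q ^ (al * k + be)) / (1 - c * q ^ (al * k + be)) =
      Lam (fun n l => if n % al = be % al then c ^ l else 0) q := by
  have hb : ∀ n l : ℕ, ‖(if n % al = be % al then c ^ l else 0 : ℂ)‖ ≤ 1 := by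
    intro n l
    split_ifs
    · rw [norm_pow]; exact pow_le_one₀ (norm_nonneg _) hc
    · simp
  rw [Lam, (Lam_summable hb hq).tsum_prod]
  have hin : ∀ n : ℕ+, ∑' l : ℕ+, (if (n : ℕ) % al = be % al then c ^ (l : ℕ) else 0 : ℂ) * ((n : ℕ) : ℂ) * q ^ ((n : ℕ) * l) =
      if (n : ℕ) % al = be % al then ((n : ℕ) : ℂ) * (c * q ^ (n : ℕ)) / (1 - c * q ^ (n : ℕ)) else 0 := by
    intro n
    split_ifs
    · have hlt : ‖c * q ^ (n : ℕ)‖ < 1 := by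
        rw [norm_mul]
        have := norm_pow_lt hq n.pos
        nlinarith [norm_nonneg c, norm_nonneg (q ^ (n : ℕ))]
      have h1 := tsum_geometric_of_norm_lt_one hlt
      have h2 := tsum_pnat_eq_tsum_succ (f := fun l : ℕ => c ^ l * ((n : ℕ) : ℂ) * q ^ ((n : ℕ) * l))
      rw [h2, div_eq_mul_inv, ← h1, ← tsum_mul_left]
      refine tsum_congr fun l => ?_
      rw [mul_pow]; ring
    · simp
  simp only [hin]
  obtain ⟨g, hg⟩ : ∃ g : ℕ → ℕ+, ∀ k, (g k : ℕ) = al * k + be :=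
    ⟨fun k => ⟨al * k + be, by omega⟩, fun k => rfl⟩
  have hinj : Function.Injective g := by
    intro x y h
    have := congrArg PNat.val h
    change (g x : ℕ) = g y at this
    rw [hg, hg, add_left_inj] at this
    exact Nat.eq_of_mul_eq_mul_left hal this
  rw [← hinj.tsum_eq]
  · refine tsum_congr fun k => ?_
    simp [hg]
  · intro n hn
    rw [Function.mem_support] at hn
    have hn' : (n : ℕ) % al = be % al := by
      by_contra h
      exact hn (by rw [if_neg h])
    refine ⟨((n : ℕ) - be) / al, ?_⟩
    apply PNat.eq
    have hle : be ≤ (n : ℕ) := by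
      by_contra hlt
      push Not at hlt
      have h1 : (n : ℕ) % al = n := Nat.mod_eq_of_lt (by omega)
      rcases hab.lt_or_eq with h | h
      · rw [Nat.mod_eq_of_lt h] at hn'; omega
      · rw [h, Nat.mod_self] at hn'; have := n.pos; omega
    have hdv : al ∣ (n : ℕ) - be := (Nat.modEq_iff_dvd' hle).1 hn'.symm
    rw [hg, Nat.mul_div_cancel' hdv]; omega

lemma Lam_coeff {w : ℕ → ℕ → ℂ} {C : ℝ} (hw : ∀ n l, ‖w n l‖ ≤ C) {q : ℂ} (hq : ‖q‖ < 1) :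
    HasSum (fun N : ℕ => (∑ x ∈ N.divisorsAntidiagonal, w x.1 x.2 * (x.1 : ℂ)) * q ^ N) (Lam w q) := by
  have h := (Lam_summable hw hq).hasSum
  have h2 := sigmaAntidiagonalEquivProd.hasSum_iff.2 h
  have h3 := h2.sigma (fun n => hasSum_fintype _)
  have h4 : HasSum (fun n : ℕ+ => (∑ x ∈ (n : ℕ).divisorsAntidiagonal, w x.1 x.2 * (x.1 : ℂ)) * q ^ (n : ℕ)) (Lam w q) := by
    refine h3.congr_fun fun n => ?_
    rw [Finset.sum_mul, ← Finset.sum_attach]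
    refine Finset.sum_congr rfl fun x _ => ?_
    simp only [Function.comp, sigmaAntidiagonalEquivProd, divisorsAntidiagonalFactors, Equiv.coe_fn_mk, PNat.mk_coe]
    rw [(Nat.mem_divisorsAntidiagonal.1 x.2).1]
  refine (PNat.coe_injective.hasSum_iff (f := fun N : ℕ => (∑ x ∈ N.divisorsAntidiagonal, w x.1 x.2 * (x.1 : ℂ)) * q ^ N) ?_).1 h4
  intro N hN
  have : N = 0 := by
    by_contra h0
    exact hN ⟨⟨N, Nat.pos_of_ne_zero h0⟩, rfl⟩
  subst this; simp

end S19

namespace S19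
open Complex Filter Topology

/-- quadratic character mod 5 -/
def chi (n : ℕ) : ℤ := if n % 5 = 1 ∨ n % 5 = 4 then 1 else if n % 5 = 2 ∨ n % 5 = 3 then -1 else 0

lemma chi_norm (n : ℕ) : ‖(chi n : ℂ)‖ ≤ 1 := by
  unfold chi; split_ifs <;> simp

lemma logmul {f g : ℂ → ℂ} {a b t : ℂ} (hf : HasDerivAt f (f t * a) t) (hg : HasDerivAt g (g t * b) t) :
    HasDerivAt (fun s => f s * g s) (f t * g t * (a + b)) t := by
  refine (hf.mul hg).congr_deriv ?_
  ring

lemma qp_deriv' {c : ℂ} (hc : ‖c‖ ≤ 1) {lam al be : ℕ} (hl : 0 < lam) (hal : 0 < al) (hbe : 0 < be)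
    (hab : be ≤ al) {t : ℂ} (ht : t.re < 0) :
    HasDerivAt (fun s => qpoch (c * (cexp s ^ lam) ^ be) ((cexp s ^ lam) ^ al))
      (qpoch (c * (cexp t ^ lam) ^ be) ((cexp t ^ lam) ^ al) *
        (-(lam : ℂ) * Lam (fun n l => if n % al = be % al then c ^ l else 0) (cexp t ^ lam))) t := by
  rw [← Lam_eval hc hal hbe hab (norm_pow_lt (exp_norm ht) hl)]
  exact qp_deriv hc hl hal hbe ht

lemma exp_pow_deriv (m : ℕ) (κ t : ℂ) : HasDerivAt (fun s => κ * cexp s ^ m) (κ * cexp t ^ m * m) t := by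
  have h1 : HasDerivAt (fun x : ℂ => (m : ℂ) * x) (m : ℂ) t := by
    simpa using (hasDerivAt_id t).const_mul (m : ℂ)
  have := (h1.cexp).const_mul κ
  simp only [Complex.exp_nat_mul] at this
  refine this.congr_deriv ?_
  ring

lemma T_deriv_eq {w w2 : ℤ → ℂ} (hw : ∀ n, ‖w n‖ ≤ 1) (h2 : ∀ n, w2 n = w n * (n : ℂ) ^ 2) {F : ℂ → ℂ} {a t : ℂ}
    (ht : t.re < 0) (hF : ∀ s : ℂ, s.re < 0 → T w s = F s) (hd : HasDerivAt F (F t * a) t) :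
    T w2 t = F t * a := by
  have h := hasDerivAt_T 1 hw ht
  have hw2 : w2 = fun n => w n * (n : ℂ) ^ 2 := funext h2
  rw [hw2]
  refine h.unique (hd.congr_of_eventuallyEq ?_)
  have : {s : ℂ | s.re < 0} ∈ 𝓝 t := (isOpen_lt Complex.continuous_re continuous_const).mem_nhds ht
  filter_upwards [this] with s hs
  exact hF s hs

lemma ec_cw_supp (b j : ℤ) (hb : (b - j) % 5 = 0) (hb2 : b % 2 = 1) (n : ℤ) (h : cw ec j n ≠ 0) : ∃ m : ℤ, 10 * m + b = n := by
  unfold cw at h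
  split_ifs at h with h1
  · obtain ⟨m, hm⟩ := ep_supp n h
    exact ⟨(n - b) / 10, by omega⟩
  · exact absurd rfl h

lemma ec_cw_val (b j m : ℤ) (hb : (b - j) % 5 = 0) (hb2 : b % 4 = 1) : cw ec j (10 * m + b) = (-1) ^ m := by
  unfold cw
  rw [if_pos (by omega), ec, show 10 * m + b = 2 * (5 * m + (b - 1) / 2) + 1 by omega, ep_odd, zpow_add₀ (by norm_num), zpow_mul]
  have : Even ((b - 1) / 2) := by rw [Int.even_iff]; omega
  rw [this.neg_one_zpow]
  norm_num

lemma th1 {t : ℂ} (ht : t.re < 0) : T (cw ec 1) t =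
    1 * cexp t ^ 1 * (qpoch (1 * (cexp t ^ 40) ^ 3) ((cexp t ^ 40) ^ 5) *
      qpoch (1 * (cexp t ^ 40) ^ 2) ((cexp t ^ 40) ^ 5) * qpoch (1 * (cexp t ^ 40) ^ 5) ((cexp t ^ 40) ^ 5)) := by
  rw [thetaProd (w := cw ec 1) 10 1 (by norm_num) (c := 1) (κ := 1) one_ne_zero
    (ec_cw_supp 1 1 (by norm_num) (by norm_num))
    (fun m => by rw [ec_cw_val 1 1 m (by norm_num) (by norm_num)]; simp) ht]
  norm_num [zpow_ofNat, ← pow_mul]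

lemma th2 {t : ℂ} (ht : t.re < 0) : T (cw ec 2) t =
    1 * cexp t ^ 9 * (qpoch (1 * (cexp t ^ 40) ^ 1) ((cexp t ^ 40) ^ 5) *
      qpoch (1 * (cexp t ^ 40) ^ 4) ((cexp t ^ 40) ^ 5) * qpoch (1 * (cexp t ^ 40) ^ 5) ((cexp t ^ 40) ^ 5)) := by
  rw [thetaProd (w := cw ec 2) 10 (-3) (by norm_num) (c := 1) (κ := 1) one_ne_zero
    (ec_cw_supp (-3) 2 (by norm_num) (by norm_num))
    (fun m => by rw [ec_cw_val (-3) 2 m (by norm_num) (by norm_num)]; simp) ht]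
  norm_num [zpow_ofNat, ← pow_mul]

lemma cw_ec_norm (j n : ℤ) : ‖cw ec j n‖ ≤ 1 := by
  unfold cw; split_ifs
  · exact ep_norm n
  · simp

lemma cw_ec2 (j n : ℤ) : cw ec2 j n = cw ec j n * (n : ℂ) ^ 2 := by
  unfold cw ec2; split_ifs <;> simp

lemma one_norm_le : ‖(1 : ℂ)‖ ≤ 1 := by simp

lemma Lam_chi {q : ℂ} (hq : ‖q‖ < 1) :
    Lam (fun n l => if n % 5 = 1 % 5 then 1 ^ l else 0) q + Lam (fun n l => if n % 5 = 4 % 5 then 1 ^ l else 0) q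
    - Lam (fun n l => if n % 5 = 2 % 5 then 1 ^ l else 0) q - Lam (fun n l => if n % 5 = 3 % 5 then 1 ^ l else 0) q
    = Lam (fun n _ => (chi n : ℂ)) q := by
  have hb : ∀ j n l : ℕ, ‖(if n % 5 = j % 5 then 1 ^ l else 0 : ℂ)‖ ≤ 1 := by
    intro j n l; split_ifs <;> simp
  have h := (((Lam_summable (hb 1) hq).hasSum.add (Lam_summable (hb 4) hq).hasSum).sub
    (Lam_summable (hb 2) hq).hasSum).sub (Lam_summable (hb 3) hq).hasSum
  refine h.unique ((Lam_summable (w := fun n _ => (chi n : ℂ)) (fun n _ => chi_norm n) hq).hasSum.congr_fun fun x => ?_)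
  rw [← add_mul, ← sub_mul, ← sub_mul, ← add_mul, ← sub_mul, ← sub_mul]
  congr 2
  unfold chi
  have h5 : ((x.1 : ℕ) % 5 = 0 ∨ (x.1 : ℕ) % 5 = 1 ∨ (x.1 : ℕ) % 5 = 2 ∨ (x.1 : ℕ) % 5 = 3 ∨ (x.1 : ℕ) % 5 = 4) := by omega
  rcases h5 with h | h | h | h | h <;> simp [h]

lemma identP {q : ℂ} (h0 : q ≠ 0) (hq : ‖q‖ < 1) :
    ff q ^ 5 = ff (q ^ 5) * (1 - 5 * Lam (fun n _ => (chi n : ℂ)) q) := by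
  obtain ⟨t, ht, hqt⟩ := exists_exp h0 hq (m := 40) (by norm_num)
  have hA := fun (be : ℕ) (h1 : 0 < be) (h2 : be ≤ 5) =>
    qp_deriv' one_norm_le (lam := 40) (al := 5) (be := be) (by norm_num) (by norm_num) h1 h2 ht
  have d1 := T_deriv_eq (cw_ec_norm 1) (cw_ec2 1) ht (fun s hs => th1 hs)
    (logmul (exp_pow_deriv 1 1 t) (logmul (logmul (hA 3 (by norm_num) (by norm_num)) (hA 2 (by norm_num) (by norm_num)))
      (hA 5 (by norm_num) (by norm_num))))
  have d2 := T_deriv_eq (cw_ec_norm 2) (cw_ec2 2) ht (fun s hs => th2 hs)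
    (logmul (exp_pow_deriv 9 1 t) (logmul (logmul (hA 1 (by norm_num) (by norm_num)) (hA 4 (by norm_num) (by norm_num)))
      (hA 5 (by norm_num) (by norm_num))))
  have hW := W_cw ht
  rw [T_ec1 (five_re ht), exp_five, d1, d2, th1 ht, th2 ht] at hW
  have e8 : (cexp t ^ 5) ^ 8 = q := by rw [← pow_mul]; exact hqt
  rw [e8] at hW
  rw [hqt] at hW
  have hl := Lam_chi hq
  have hd := qp_dissect q hq (m := 5) (by norm_num)
  simp only [Finset.prod_range_succ, Finset.prod_range_zero] at hd
  simp only [one_mul, ← pow_succ', ← pow_two, pow_zero, mul_one, pow_one, Nat.reduceAdd] at hd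
  simp only [one_mul, pow_one] at hW
  have hf1 := ff_ne hq
  have hp : cexp t ≠ 0 := Complex.exp_ne_zero t
  rw [← hl]
  have hd' : ff q = qpoch q (q ^ 5) * qpoch (q ^ 2) (q ^ 5) * qpoch (q ^ 3) (q ^ 5) * qpoch (q ^ 4) (q ^ 5) * ff (q ^ 5) := by
    unfold ff; exact hd
  have hc : (cexp t ^ 10 * ff q * 8) ≠ 0 := by simp [hf1, hp]
  apply mul_left_cancel₀ hc
  change _ = 2 * (2 * cexp t ^ 5 * ff q ^ 3) ^ 2 at hW
  push_cast at hW
  rw [show qpoch (q ^ 5) (q ^ 5) = ff (q ^ 5) from rfl] at hW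
  linear_combination (-1) * hW - 8 * cexp t ^ 10 * ff (q ^ 5) *
    (1 - 5 * (Lam (fun n l => if n % 5 = 1 % 5 then 1 ^ l else 0) q + Lam (fun n l => if n % 5 = 4 % 5 then 1 ^ l else 0) q
    - Lam (fun n l => if n % 5 = 2 % 5 then 1 ^ l else 0) q - Lam (fun n l => if n % 5 = 3 % 5 then 1 ^ l else 0) q)) * hd'

lemma tw_ec_val (y : ℂ) (hy : y ≠ 0) (m : ℤ) : tw ec y (2 * m + 1) = y * ((-1) ^ m * (y ^ 2) ^ m) := by
  unfold tw ec
  rw [ep_odd, zpow_add₀ hy, zpow_mul, zpow_one, zpow_ofNat]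
  ring

lemma thS {y : ℂ} (hy5 : y ^ 5 = 1) {t : ℂ} (ht : t.re < 0) : T (tw ec y) t =
    y * (1 - y ^ 3) * cexp t ^ 1 * (qpoch (y ^ 2 * (cexp t ^ 8) ^ 1) ((cexp t ^ 8) ^ 1) *
      qpoch (y ^ 3 * (cexp t ^ 8) ^ 1) ((cexp t ^ 8) ^ 1) * qpoch (1 * (cexp t ^ 8) ^ 1) ((cexp t ^ 8) ^ 1)) := by
  have hy : y ≠ 0 := by rintro rfl; simp at hy5
  rw [thetaProd (w := tw ec y) 2 1 (by norm_num) (c := y ^ 2) (κ := y) (pow_ne_zero 2 hy)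
    (fun n h => ep_supp n (left_ne_zero_of_mul h)) (tw_ec_val y hy) ht]
  have i2 : (y ^ 2)⁻¹ = y ^ 3 := inv_eq_of_mul_eq_one_right (by rw [← pow_add]; exact hy5)
  rw [i2]
  norm_num [zpow_ofNat]
  rw [qp_shift (y ^ 3) (norm_pow_lt (exp_norm ht) (m := 8) (by norm_num))]
  ring

lemma tw_ec_norm {y : ℂ} (hy : ‖y‖ = 1) (n : ℤ) : ‖tw ec y n‖ ≤ 1 := by
  unfold tw
  rw [norm_mul, norm_zpow, hy, one_zpow, mul_one]; exact ep_norm n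

lemma tw_ec2 (y : ℂ) (n : ℤ) : tw ec2 y n = tw ec y n * (n : ℂ) ^ 2 := by
  unfold tw ec2; ring

lemma root_norm {y : ℂ} (hy5 : y ^ 5 = 1) : ‖y‖ = 1 := by
  have : ‖y‖ ^ 5 = 1 := by rw [← norm_pow, hy5, norm_one]
  exact (pow_eq_one_iff_of_nonneg (norm_nonneg _) (by norm_num)).1 this

/-- Lambert series of a twist -/
noncomputable def LT (c q : ℂ) : ℂ := Lam (fun n l => if n % 1 = 1 % 1 then c ^ l else 0) q

lemma thS_deriv {y : ℂ} (hy5 : y ^ 5 = 1) {t : ℂ} (ht : t.re < 0) : T (tw ec2 y) t =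
    T (tw ec y) t * (1 - 8 * (LT (y ^ 2) (cexp t ^ 8) + LT (y ^ 3) (cexp t ^ 8) + LT 1 (cexp t ^ 8))) := by
  have hy := root_norm hy5
  have hyk : ∀ k : ℕ, ‖y ^ k‖ ≤ 1 := fun k => by rw [norm_pow, hy, one_pow]
  have hA := fun (c : ℂ) (hc : ‖c‖ ≤ 1) =>
    qp_deriv' hc (lam := 8) (al := 1) (be := 1) (by norm_num) (by norm_num) (by norm_num) (by norm_num) ht
  have d1 := T_deriv_eq (tw_ec_norm hy) (tw_ec2 y) ht (fun s hs => thS hy5 hs)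
    (logmul (exp_pow_deriv 1 _ t) (logmul (logmul (hA _ (hyk 2)) (hA _ (hyk 3)))
      (hA 1 one_norm_le)))
  rw [d1, thS hy5 ht]
  unfold LT
  push_cast
  ring

lemma zeta_chi {z : ℂ} (hz5 : z ^ 5 = 1) (l : ℕ) :
    (z ^ 2) ^ l + (z ^ 3) ^ l - (z ^ 4) ^ l - z ^ l = -(z + z ^ 4 - z ^ 2 - z ^ 3) * (chi l : ℂ) := by
  have key : ∀ k : ℕ, (z ^ k) ^ l = (z ^ (l % 5)) ^ k := by
    intro k
    have h1 : z ^ l = z ^ (l % 5) := by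
      conv_lhs => rw [← Nat.mod_add_div l 5]
      rw [pow_add, pow_mul, hz5]; simp
    rw [← h1, ← pow_mul, ← pow_mul, mul_comm]
  have k1 := key 1; rw [pow_one, pow_one] at k1
  rw [k1, key 2, key 3, key 4]
  unfold chi
  have h5 : (l % 5 = 0 ∨ l % 5 = 1 ∨ l % 5 = 2 ∨ l % 5 = 3 ∨ l % 5 = 4) := by omega
  rcases h5 with h | h | h | h | h <;> rw [h]
  · norm_num
  · norm_num; ring
  · norm_num; linear_combination (z - z ^ 3) * hz5
  · norm_num; linear_combination (z + z ^ 4 - z ^ 2 - z ^ 7) * hz5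
  · norm_num; linear_combination (z ^ 3 + z ^ 7 + z ^ 2 - z ^ 11 - z ^ 6 - z) * hz5

lemma LT_chi {z : ℂ} (hz5 : z ^ 5 = 1) {q : ℂ} (hq : ‖q‖ < 1) :
    LT (z ^ 2) q + LT (z ^ 3) q - LT (z ^ 4) q - LT z q
    = -(z + z ^ 4 - z ^ 2 - z ^ 3) * Lam (fun _ l => (chi l : ℂ)) q := by
  have hz := root_norm hz5
  have hb : ∀ c : ℂ, ‖c‖ = 1 → ∀ n l : ℕ, ‖(if n % 1 = 1 % 1 then c ^ l else 0 : ℂ)‖ ≤ 1 := by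
    intro c hc n l; split_ifs <;> simp [hc]
  have hk : ∀ k : ℕ, ‖z ^ k‖ = 1 := fun k => by rw [norm_pow, hz, one_pow]
  have h := (((Lam_summable (hb _ (hk 2)) hq).hasSum.add (Lam_summable (hb _ (hk 3)) hq).hasSum).sub
    (Lam_summable (hb _ (hk 4)) hq).hasSum).sub (Lam_summable (hb _ hz) hq).hasSum
  refine h.unique (((Lam_summable (w := fun _ l => (chi l : ℂ)) (fun _ l => chi_norm l) hq).hasSum.mul_left _).congr_fun fun x => ?_)
  have e := zeta_chi hz5 x.2
  simp only [Nat.mod_one, if_true]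
  linear_combination ((x.1 : ℕ) : ℂ) * q ^ ((x.1 : ℕ) * x.2) * e

lemma identQ {q : ℂ} (h0 : q ≠ 0) (hq : ‖q‖ < 1) :
    q * ff (q ^ 5) ^ 5 = ff q * Lam (fun _ l => (chi l : ℂ)) q := by
  obtain ⟨t, ht, hqt⟩ := exists_exp h0 hq (m := 8) (by norm_num)
  obtain ⟨z, hz5, hz1⟩ := exists_zeta
  have hz25 : (z ^ 2) ^ 5 = 1 := by rw [← pow_mul, mul_comm, pow_mul, hz5, one_pow]
  have hW := W_tw ht hz5 hz1
  rw [T_ec1 (five_re ht), exp_five, thS_deriv hz5 ht, thS_deriv hz25 ht, thS hz5 ht, thS hz25 ht] at hW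
  have e8 : (cexp t ^ 5) ^ 8 = q ^ 5 := by rw [← hqt]; ring
  have z4 : (z ^ 2) ^ 2 = z ^ 4 := by ring
  have z6 : (z ^ 2) ^ 3 = z := by linear_combination z * hz5
  rw [e8, hqt, z4, z6] at hW
  simp only [one_mul, pow_one] at hW
  have h5 := qp_five hz5 hz1 q hq
  have hl := LT_chi hz5 hq
  have hp : cexp t ≠ 0 := Complex.exp_ne_zero t
  have hg : (z + z ^ 4 - z ^ 2 - z ^ 3) ^ 2 = 5 := by
    linear_combination (-1) * hz1 + (z ^ 3 - 2 * z ^ 2 - z + 4) * hz5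
  have hgz : z * (1 - z ^ 3) * (z ^ 2 * (1 - z)) = -(z + z ^ 4 - z ^ 2 - z ^ 3) := by
    linear_combination (z ^ 2 - z) * hz5
  have hc : cexp t ^ 2 * ff (q ^ 5) ≠ 0 := by simp [hp, ff_ne (norm_pow_lt hq (m := 5) (by norm_num))]
  apply mul_left_cancel₀ hc
  rw [show qpoch (q ^ 5) (q ^ 5) = ff (q ^ 5) from rfl, show qpoch q q = ff q from rfl] at h5
  rw [show qpoch q q = ff q from rfl] at hW
  generalize Lam (fun _ l => (chi l : ℂ)) q = LE at *
  generalize ff q = f1 at *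
  generalize ff (q ^ 5) = f5 at *
  generalize qpoch (z * q) q = B1 at *
  generalize qpoch (z ^ 2 * q) q = B2 at *
  generalize qpoch (z ^ 3 * q) q = B3 at *
  generalize qpoch (z ^ 4 * q) q = B4 at *
  generalize LT (z ^ 2) q = L2 at *
  generalize LT (z ^ 3) q = L3 at *
  generalize LT (z ^ 4) q = L4 at *
  generalize LT z q = L1 at *
  generalize hgg : z + z ^ 4 - z ^ 2 - z ^ 3 = g at *
  have hA : z * (1 - z ^ 3) * (z ^ 2 * (1 - z)) * cexp t ^ 2 * (f1 * (f1 * B1 * B2 * B3 * B4)) * (-8 * (L2 + L3 - L4 - L1)) =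
      -40 * cexp t ^ 10 * f5 ^ 6 := by
    linear_combination hW
  rw [hgz, h5, hl] at hA
  rw [← hqt]
  linear_combination (1 / 40) * hA + (1 / 5) * cexp t ^ 2 * f1 * f5 * LE * hg

end S19

namespace S19
open Complex Filter Topology

/-- first divisor sum -/
def Fd (N : ℕ) : ℤ := ∑ x ∈ N.divisorsAntidiagonal, chi x.1 * x.1
/-- second divisor sum -/
def Ed (N : ℕ) : ℤ := ∑ x ∈ N.divisorsAntidiagonal, chi x.2 * x.1

/-- series of `Fd` -/
noncomputable def LF (q : ℂ) : ℂ := Lam (fun n _ => (chi n : ℂ)) q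
/-- series of `Ed` -/
noncomputable def LE (q : ℂ) : ℂ := Lam (fun _ l => (chi l : ℂ)) q

lemma LF_sum {q : ℂ} (hq : ‖q‖ < 1) : HasSum (fun N => (Fd N : ℂ) * q ^ N) (LF q) := by
  refine (Lam_coeff (w := fun n _ => (chi n : ℂ)) (fun n _ => chi_norm n) hq).congr_fun fun N => ?_
  unfold Fd; push_cast; rfl

lemma LE_sum {q : ℂ} (hq : ‖q‖ < 1) : HasSum (fun N => (Ed N : ℂ) * q ^ N) (LE q) := by
  refine (Lam_coeff (w := fun _ l => (chi l : ℂ)) (fun _ l => chi_norm l) hq).congr_fun fun N => ?_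
  unfold Ed; push_cast; rfl

lemma dbl_sum {f : ℕ → ℂ} {q s : ℂ} (h : HasSum (fun N => f N * (q ^ 2) ^ N) s) :
    HasSum (fun N => (if 2 ∣ N then f (N / 2) else 0) * q ^ N) s := by
  have hinj : Function.Injective (fun N : ℕ => 2 * N) := fun x y h => by simpa using h
  refine (hinj.hasSum_iff (f := fun N => (if 2 ∣ N then f (N / 2) else 0) * q ^ N) ?_).1 ?_
  · intro N hN
    rw [if_neg, zero_mul]
    rintro ⟨k, rfl⟩
    exact hN ⟨k, rfl⟩
  · refine h.congr_fun fun N => ?_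
    simp [pow_mul]

lemma sh_sum {f : ℕ → ℂ} {q s : ℂ} (h : HasSum (fun N => f N * q ^ N) s) :
    HasSum (fun N => (if 3 ≤ N then f (N - 3) else 0) * q ^ N) (q ^ 3 * s) := by
  have hinj : Function.Injective (fun N : ℕ => N + 3) := fun x y h => by simpa using h
  refine (hinj.hasSum_iff (f := fun N => (if 3 ≤ N then f (N - 3) else 0) * q ^ N) ?_).1 ?_
  · intro N hN
    rw [if_neg, zero_mul]
    intro h3
    exact hN ⟨N - 3, by simp only; omega⟩
  · refine (h.mul_left (q ^ 3)).congr_fun fun N => ?_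
    simp; ring

lemma coeff_zero {c : ℕ → ℂ} (h : ∀ q : ℂ, q ≠ 0 → ‖q‖ < 1 → HasSum (fun n => c n * q ^ n) 0) (n : ℕ) : c n = 0 := by
  set p : FormalMultilinearSeries ℂ ℂ ℂ := FormalMultilinearSeries.ofScalars ℂ c with hp
  set f : ℂ → ℂ := fun q => if q = 0 then c 0 else 0 with hf
  have hr : ((1 / 2 : NNReal) : ENNReal) ≤ p.radius := by
    apply FormalMultilinearSeries.le_radius_of_tendsto (l := 0)
    have := (h (1 / 2) (by norm_num) (by norm_num)).summable.tendsto_atTop_zero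
    have := this.norm
    rw [norm_zero] at this
    refine this.congr fun k => ?_
    rw [hp, FormalMultilinearSeries.ofScalars_norm]
    simp
  have hfp : HasFPowerSeriesOnBall f p 0 ((1 / 2 : NNReal) : ENNReal) := by
    refine ⟨hr, by simp, ?_⟩
    intro y hy
    rw [zero_add]
    have hy' : ‖y‖ < 1 := by
      have h2 : (‖y‖₊ : ENNReal) < ((1 / 2 : NNReal) : ENNReal) := by simpa [edist_zero_right, enorm] using hy
      have h3 : ‖y‖₊ < 1 / 2 := by exact_mod_cast h2
      have h4 : (‖y‖₊ : ℝ) < ((1 / 2 : NNReal) : ℝ) := by exact_mod_cast h3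
      simp at h4
      linarith
    have e : (fun n => p n fun _ => y) = fun n => c n * y ^ n := by
      funext n
      rw [hp]; simp [FormalMultilinearSeries.ofScalars]
    rw [e]
    by_cases h0 : y = 0
    · subst h0
      simp only [hf, if_true]
      have := hasSum_single (f := fun n => c n * (0 : ℂ) ^ n) 0 (fun b hb => by simp [hb])
      simpa using this
    · simp only [hf, if_neg h0]
      exact h y h0 hy'
  have hc : ContinuousAt f 0 := hfp.hasFPowerSeriesAt.continuousAt
  have hf0 : c 0 = 0 := by
    have h1 : Tendsto f (𝓝[≠] 0) (𝓝 (f 0)) := hc.tendsto.mono_left nhdsWithin_le_nhds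
    have h2 : Tendsto f (𝓝[≠] 0) (𝓝 0) := by
      refine tendsto_const_nhds.congr' ?_
      filter_upwards [self_mem_nhdsWithin] with x hx
      have hx' : x ≠ 0 := hx
      simp only [hf]; rw [if_neg hx']
    have := tendsto_nhds_unique h1 h2
    simpa [hf] using this
  have hfz : f = 0 := by
    funext x; simp [hf, hf0]
  have hat := hfp.hasFPowerSeriesAt
  rw [hfz] at hat
  have hp0 := hat.eq_zero
  have := congrArg (fun s : FormalMultilinearSeries ℂ ℂ ℂ => s.coeff n) hp0
  have hz : (0 : FormalMultilinearSeries ℂ ℂ ℂ).coeff n = 0 := rfl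
  simp only [hp, FormalMultilinearSeries.coeff_ofScalars, hz] at this
  exact this

lemma identA {q : ℂ} (h0 : q ≠ 0) (hq : ‖q‖ < 1) :
    5 * (phiNeg (q ^ 5) ^ 5 / phiNeg q) = 4 * (1 - 5 * LF (q ^ 2)) + (1 - 5 * LF q) + 20 * LE (q ^ 2) + 15 * LE q ∧
    4 * (q ^ 3 * (psiNeg ((-q) ^ 5) ^ 5 / psiNeg (-q))) = LF (q ^ 2) - LF q - 3 * LE (q ^ 2) + LE q := by
  have n2 := norm_pow_lt hq (m := 2) (by norm_num)
  have n5 := norm_pow_lt hq (m := 5) (by norm_num)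
  have n10 := norm_pow_lt hq (m := 10) (by norm_num)
  have psi : ∀ r : ℂ, ‖r‖ < 1 → psiNeg (-r) = ff (r ^ 2) ^ 2 / ff r := by
    intro r hr
    have hr2 := norm_pow_lt hr (m := 2) (by norm_num)
    have a1 := ff_dissect hr
    have a2 := ff_dissect (q := -r) (by simpa using hr)
    have a3 := ff_dissect hr2
    have a4 := qp_neg r hr2
    rw [← a4] at a3
    have f2 := ff_ne hr2
    have f1 := ff_ne hr
    have e2 : (-r) ^ 2 = r ^ 2 := by ring
    have e4 : (-r) ^ 4 = (r ^ 2) ^ 2 := by ring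
    unfold psiNeg
    rw [e2, e4]
    change ff (-r) * ff ((r ^ 2) ^ 2) / ff (r ^ 2) = _
    rw [e2] at a2
    rw [div_eq_div_iff f2 f1, a2, a1]
    linear_combination (-(ff (r ^ 2) ^ 2)) * a3
  have i1 := identI h0 hq
  have i2 := identII h0 hq
  have p1 := identP h0 hq
  have p2 := identP (pow_ne_zero 2 h0) n2
  have q1 := identQ h0 hq
  have q2 := identQ (pow_ne_zero 2 h0) n2
  have e1 : (-q) ^ 5 = -(q ^ 5) := by ring
  rw [e1, psi q hq, psi _ n5]
  have e10 : (q ^ 5) ^ 2 = q ^ 10 := by ring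
  have e10' : (q ^ 2) ^ 5 = q ^ 10 := by ring
  have hphi : phiNeg q = ff q ^ 2 / ff (q ^ 2) := rfl
  have hPhi : phiNeg (q ^ 5) = ff (q ^ 5) ^ 2 / ff (q ^ 10) := by rw [← e10]; rfl
  rw [e10'] at p2 q2
  rw [e10]
  change _ = _ * (1 - 5 * LF q) at p1
  change _ = _ * (1 - 5 * LF (q ^ 2)) at p2
  change _ = _ * LE q at q1
  change _ = _ * LE (q ^ 2) at q2
  have f1 := ff_ne hq
  have f2 := ff_ne n2
  have f5 := ff_ne n5
  have f10 := ff_ne n10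
  generalize ff q = x1 at *
  generalize ff (q ^ 2) = x2 at *
  generalize ff (q ^ 5) = x5 at *
  generalize ff (q ^ 10) = x10 at *
  generalize LF q = l1 at *
  generalize LF (q ^ 2) = l2 at *
  generalize LE q = m1 at *
  generalize LE (q ^ 2) = m2 at *
  generalize phiNeg q = φ at *
  generalize phiNeg (q ^ 5) = Φ at *
  have hφ0 : φ ≠ 0 := by rw [hphi]; exact div_ne_zero (pow_ne_zero 2 f1) f2
  have hΦ0 : Φ ≠ 0 := by rw [hPhi]; exact div_ne_zero (pow_ne_zero 2 f5) f10
  have D1 : Φ ^ 2 - φ ^ 2 = 4 * q * x1 * x10 ^ 3 / (x2 * x5) := by rw [eq_div_iff (by positivity)]; exact i1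
  have D2 : 5 * Φ ^ 2 - φ ^ 2 = 4 * x5 * x2 ^ 3 / (x1 * x10) := by rw [eq_div_iff (by positivity)]; exact i2
  have P1 : 1 - 5 * l1 = φ ^ 3 * (5 * Φ ^ 2 - φ ^ 2) / (4 * Φ) := by
    have : 1 - 5 * l1 = x1 ^ 5 / x5 := by rw [p1]; field_simp
    rw [this, D2, hphi, hPhi]; field_simp
  have P2 : 1 - 5 * l2 = φ * (5 * Φ ^ 2 - φ ^ 2) ^ 2 / (16 * Φ) := by
    have : 1 - 5 * l2 = x2 ^ 5 / x10 := by rw [p2]; field_simp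
    rw [this, D2, hphi, hPhi]; field_simp; norm_num
  have Q1 : m1 = Φ ^ 3 * (Φ ^ 2 - φ ^ 2) / (4 * φ) := by
    have : m1 = q * x5 ^ 5 / x1 := by rw [q1]; field_simp
    rw [this, D1, hphi, hPhi]; field_simp
  have Q2 : m2 = Φ * (Φ ^ 2 - φ ^ 2) ^ 2 / (16 * φ) := by
    have : m2 = q ^ 2 * x10 ^ 5 / x2 := by rw [q2]; field_simp
    rw [this, D1, hphi, hPhi]; field_simp; norm_num
  have C : q ^ 3 * ((x10 ^ 2 / x5) ^ 5 / (x2 ^ 2 / x1)) = (Φ ^ 2 - φ ^ 2) ^ 3 / (64 * Φ * φ) := by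
    rw [D1, hphi, hPhi]; field_simp; norm_num
  constructor
  · rw [P1, P2, Q1, Q2]; field_simp; ring
  · rw [C]
    have hh : l2 - l1 = ((1 - 5 * l1) - (1 - 5 * l2)) / 5 := by ring
    rw [hh, P1, P2, Q1, Q2]; field_simp; ring

end S19

namespace S19
open Complex Filter Topology

lemma chi_two (n : ℕ) : chi (2 * n) = - chi n := by
  unfold chi; split_ifs <;> omega

lemma div_double {m : ℕ} (hm : m % 2 = 1) (g : ℕ × ℕ → ℤ) :
    ∑ x ∈ (2 * m).divisorsAntidiagonal, g x =
      ∑ x ∈ m.divisorsAntidiagonal, g (2 * x.1, x.2) + ∑ x ∈ m.divisorsAntidiagonal, g (x.1, 2 * x.2) := by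
  have h1 : (2 * m).divisorsAntidiagonal = m.divisorsAntidiagonal.image (fun x => (2 * x.1, x.2)) ∪
      m.divisorsAntidiagonal.image (fun x => (x.1, 2 * x.2)) := by
    ext ⟨a, b⟩
    simp only [Nat.mem_divisorsAntidiagonal, Finset.mem_union, Finset.mem_image, Prod.mk.injEq, Prod.exists]
    constructor
    · rintro ⟨hab, h0⟩
      have hev : 2 ∣ a * b := ⟨m, hab⟩
      rcases (Nat.Prime.dvd_mul Nat.prime_two).1 hev with ⟨k, hk⟩ | ⟨k, hk⟩
      · left
        refine ⟨k, b, ⟨?_, by omega⟩, hk.symm, rfl⟩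
        rw [hk, mul_assoc] at hab; omega
      · right
        refine ⟨a, k, ⟨?_, by omega⟩, rfl, hk.symm⟩
        rw [hk, mul_left_comm] at hab; omega
    · rintro (⟨x, y, ⟨hxy, h0⟩, rfl, rfl⟩ | ⟨x, y, ⟨hxy, h0⟩, rfl, rfl⟩)
      · refine ⟨by rw [← hxy]; ring, by omega⟩
      · refine ⟨by rw [← hxy]; ring, by omega⟩
  rw [h1, Finset.sum_union, Finset.sum_image, Finset.sum_image]
  · rintro ⟨a, b⟩ _ ⟨c, d⟩ _ h
    simp only [Prod.mk.injEq] at h ⊢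
    omega
  · rintro ⟨a, b⟩ _ ⟨c, d⟩ _ h
    simp only [Prod.mk.injEq] at h ⊢
    omega
  · rw [Finset.disjoint_left]
    rintro ⟨a, b⟩ hx hy
    simp only [Nat.mem_divisorsAntidiagonal, Finset.mem_image, Prod.mk.injEq, Prod.exists] at hx hy
    obtain ⟨x, y, ⟨hxy, h0⟩, rfl, rfl⟩ := hx
    obtain ⟨x', y', ⟨hxy', h0'⟩, hx, rfl⟩ := hy
    rw [mul_left_comm] at hxy
    omega

lemma Ed_two {m : ℕ} (hm : m % 2 = 1) : Ed (2 * m) = Ed m := by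
  unfold Ed
  rw [div_double hm, ← Finset.sum_add_distrib]
  refine Finset.sum_congr rfl fun x _ => ?_
  simp only [chi_two]; push_cast; ring

lemma Fd_two {m : ℕ} (hm : m % 2 = 1) : Fd (2 * m) = - Fd m := by
  unfold Fd
  rw [div_double hm, ← Finset.sum_add_distrib, ← Finset.sum_neg_distrib]
  refine Finset.sum_congr rfl fun x _ => ?_
  simp only [chi_two]; push_cast; ring

lemma Fd_eq {m : ℕ} (hm : m % 5 = 2 ∨ m % 5 = 3) : Fd m = - Ed m := by
  unfold Fd Ed
  rw [← Finset.sum_neg_distrib]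
  refine Finset.sum_congr rfl fun x hx => ?_
  have h := (Nat.mem_divisorsAntidiagonal.1 hx).1
  have : chi x.1 = - chi x.2 := by
    rw [← h, Nat.mul_mod] at hm
    have h5 : (x.1 % 5 = 0 ∨ x.1 % 5 = 1 ∨ x.1 % 5 = 2 ∨ x.1 % 5 = 3 ∨ x.1 % 5 = 4) := by omega
    have h6 : (x.2 % 5 = 0 ∨ x.2 % 5 = 1 ∨ x.2 % 5 = 2 ∨ x.2 % 5 = 3 ∨ x.2 % 5 = 4) := by omega
    unfold chi
    rcases h5 with h | h | h | h | h <;> rcases h6 with h' | h' | h' | h' | h' <;>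
      simp [h, h'] at hm ⊢
  rw [this]; ring

lemma hs_of_tsum {c : ℕ → ℤ} {q s : ℂ} (h : ∑' n : ℕ, (c n : ℂ) * q ^ n = s) (hs : s ≠ 0) :
    HasSum (fun n => (c n : ℂ) * q ^ n) s := by
  have : Summable (fun n => (c n : ℂ) * q ^ n) := by
    by_contra hn
    rw [tsum_eq_zero_of_not_summable hn] at h
    exact hs h.symm
  rw [← h]; exact this.hasSum

lemma phi_ne {q : ℂ} (hq : ‖q‖ < 1) : phiNeg q ≠ 0 :=
  div_ne_zero (pow_ne_zero 2 (ff_ne hq)) (ff_ne (norm_pow_lt hq (by norm_num)))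

lemma psi_ne {q : ℂ} (hq : ‖q‖ < 1) : psiNeg q ≠ 0 :=
  div_ne_zero (mul_ne_zero (ff_ne hq) (ff_ne (norm_pow_lt hq (by norm_num)))) (ff_ne (norm_pow_lt hq (by norm_num)))

section
variable (a b : ℕ → ℤ)

lemma a_coeff (ha : ∀ q : ℂ, ‖q‖ < 1 → ∑' n : ℕ, (a n : ℂ) * q ^ n = phiNeg (q ^ 5) ^ 5 / phiNeg q)
    {m : ℕ} (hm : m % 2 = 1) (hm5 : m % 5 = 2 ∨ m % 5 = 3) : a (2 * m) = 10 * Ed m := by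
  have key := coeff_zero (c := fun N => 5 * (a N : ℂ) + 20 * (if 2 ∣ N then (Fd (N / 2) : ℂ) else 0) + 5 * (Fd N : ℂ)
    - 20 * (if 2 ∣ N then (Ed (N / 2) : ℂ) else 0) - 15 * (Ed N : ℂ) - (if N = 0 then 5 else 0)) (fun q h0 hq => by
      have n2 := norm_pow_lt hq (m := 2) (by norm_num)
      have n5 := norm_pow_lt hq (m := 5) (by norm_num)
      have hA := hs_of_tsum (ha q hq) (div_ne_zero (pow_ne_zero 5 (phi_ne n5)) (phi_ne hq))
      have h5 : HasSum (fun N : ℕ => (if N = 0 then 5 else 0 : ℂ) * q ^ N) 5 := by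
        have := hasSum_single (f := fun N : ℕ => (if N = 0 then 5 else 0 : ℂ) * q ^ N) 0 (fun N hN => by simp [hN])
        simpa using this
      have := (((((hA.mul_left 5).add ((dbl_sum (LF_sum n2)).mul_left 20)).add ((LF_sum hq).mul_left 5)).sub
        ((dbl_sum (LE_sum n2)).mul_left 20)).sub ((LE_sum hq).mul_left 15)).sub h5
      rw [(identA h0 hq).1] at this
      have e : ∀ x y : ℂ, x = y → HasSum (fun N => (5 * (a N : ℂ) + 20 * (if 2 ∣ N then (Fd (N / 2) : ℂ) else 0) + 5 * (Fd N : ℂ)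
    - 20 * (if 2 ∣ N then (Ed (N / 2) : ℂ) else 0) - 15 * (Ed N : ℂ) - (if N = 0 then 5 else 0)) * q ^ N) x → HasSum (fun N => (5 * (a N : ℂ) + 20 * (if 2 ∣ N then (Fd (N / 2) : ℂ) else 0) + 5 * (Fd N : ℂ)
    - 20 * (if 2 ∣ N then (Ed (N / 2) : ℂ) else 0) - 15 * (Ed N : ℂ) - (if N = 0 then 5 else 0)) * q ^ N) y := by
        intro x y h; rw [h]; exact id
      refine e _ _ ?_ (this.congr_fun fun N => ?_)
      · ring
      · ring) (2 * m)
  have hm0 : m ≠ 0 := by omega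
  rw [if_pos (Dvd.intro m rfl), if_pos (Dvd.intro m rfl), if_neg (by omega), Nat.mul_div_cancel_left m (by norm_num),
    Ed_two hm, Fd_two hm, Fd_eq hm5] at key
  have : ((a (2 * m) : ℤ) : ℂ) = ((10 * Ed m : ℤ) : ℂ) := by
    push_cast at key ⊢
    linear_combination key / 5
  exact_mod_cast this

lemma b_coeff (hb : ∀ q : ℂ, ‖q‖ < 1 → ∑' n : ℕ, (b n : ℂ) * q ^ n = psiNeg (q ^ 5) ^ 5 / psiNeg q)
    {n : ℕ} (hm : n % 2 = 0) (hm5 : (n + 3) % 5 = 2 ∨ (n + 3) % 5 = 3) : 2 * b n = Ed (n + 3) := by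
  have key := coeff_zero (c := fun N => 4 * (if 3 ≤ N then (-1 : ℂ) ^ (N - 3) * (b (N - 3) : ℂ) else 0)
    - (if 2 ∣ N then (Fd (N / 2) : ℂ) else 0) + (Fd N : ℂ)
    + 3 * (if 2 ∣ N then (Ed (N / 2) : ℂ) else 0) - (Ed N : ℂ)) (fun q h0 hq => by
      have n2 := norm_pow_lt hq (m := 2) (by norm_num)
      have hq' : ‖-q‖ < 1 := by simpa using hq
      have n5 := norm_pow_lt hq' (m := 5) (by norm_num)
      have hB := hs_of_tsum (hb (-q) hq') (div_ne_zero (pow_ne_zero 5 (psi_ne n5)) (psi_ne hq'))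
      have hB' : HasSum (fun N => ((-1 : ℂ) ^ N * (b N : ℂ)) * q ^ N) (psiNeg ((-q) ^ 5) ^ 5 / psiNeg (-q)) := by
        refine hB.congr_fun fun N => ?_
        rw [neg_pow q]; ring
      have := (((((sh_sum hB').mul_left 4).sub (dbl_sum (LF_sum n2))).add (LF_sum hq)).add
        ((dbl_sum (LE_sum n2)).mul_left 3)).sub (LE_sum hq)
      rw [(identA h0 hq).2] at this
      have e : LF (q ^ 2) - LF q - 3 * LE (q ^ 2) + LE q - LF (q ^ 2) + LF q + 3 * LE (q ^ 2) - LE q = 0 := by ring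
      rw [e] at this
      refine this.congr_fun fun N => ?_
      ring) (n + 3)
  have hnd : ¬ 2 ∣ n + 3 := by omega
  rw [if_neg hnd, if_neg hnd, if_pos (by omega), Nat.add_sub_cancel, (Nat.even_iff.2 hm).neg_one_pow, Fd_eq hm5] at key
  have : ((2 * b n : ℤ) : ℂ) = ((Ed (n + 3) : ℤ) : ℂ) := by
    push_cast at key ⊢
    linear_combination key / 2
  exact_mod_cast this

end

end S19

theorem stmt_19 (a b : ℕ → ℤ)
    (ha : ∀ q : ℂ, ‖q‖ < 1 →
      ∑' n : ℕ, (a n : ℂ) * q ^ n = phiNeg (q ^ 5) ^ 5 / phiNeg q)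
    (hb : ∀ q : ℂ, ‖q‖ < 1 →
      ∑' n : ℕ, (b n : ℂ) * q ^ n = psiNeg (q ^ 5) ^ 5 / psiNeg q) :
    ∀ n : ℕ, a (20 * n + 6) = 20 * b (10 * n) ∧ a (20 * n + 14) = 20 * b (10 * n + 4) := by
  intro n
  have a1 := S19.a_coeff a ha (m := 10 * n + 3) (by omega) (by omega)
  have a2 := S19.a_coeff a ha (m := 10 * n + 7) (by omega) (by omega)
  have b1 := S19.b_coeff b hb (n := 10 * n) (by omega) (by omega)
  have b2 := S19.b_coeff b hb (n := 10 * n + 4) (by omega) (by omega)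
  rw [show 2 * (10 * n + 3) = 20 * n + 6 by ring] at a1
  rw [show 2 * (10 * n + 7) = 20 * n + 14 by ring] at a2
  rw [show 10 * n + 4 + 3 = 10 * n + 7 by ring] at b2
  constructor
  · rw [a1, ← b1]; ring
  · rw [a2, ← b2]; ring
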